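/- arXiv:1011.2081 — 5 statements merged into one kernel-verified Lean document; each statement's English description precedes it below -/
import Mathlib

section
/- Every generalized Nevanlinna function Q with one negative square admits a factorization Q(z) = R(z)·M(z) (as an identity of meromorphic functions on ℂ∖ℝ), where M is a Nevanlinna function and R is a rational function of exactly one of the following forms: (i) R(z) = (z−α)(z−conj α)/((z−β)(z−conj β)) with α, β ∈ ℂ⁺ ∪ ℝ and α ≠ β; (ii) R(z) = 1/((z−β)(z−conj β)) with β ∈ ℂ⁺ ∪ ℝ; (iii) R(z) = (z−α)(z−conj α) with α ∈ ℂ⁺ ∪ ℝ. -/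
open Complex MeasureTheory Filter Set

noncomputable def negEigCount {n : ℕ} (A : Matrix (Fin n) (Fin n) ℂ) : ℕ :=
  if h : A.IsHermitian then (Finset.univ.filter (fun i => h.eigenvalues i < 0)).card else 0

noncomputable def nevKernel (Q : ℂ → ℂ) {n : ℕ} (z : Fin n → ℂ) :
    Matrix (Fin n) (Fin n) ℂ :=
  Matrix.of fun i j => (Q (z i) - (starRingEnd ℂ) (Q (z j))) / (z i - (starRingEnd ℂ) (z j))

/-- A generalized Nevanlinna function with one negative square: `Q` is holomorphic on a
domain `D ⊆ ℂ∖ℝ` whose complement in `ℂ∖ℝ` is discrete, is symmetric with respect to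
conjugation, and the supremum over finite tuples of points of `D ∩ ℂ⁺` of the number of
negative eigenvalues of the Nevanlinna kernel matrix equals `1`. -/
structure IsGenNevanlinnaOne (Q : ℂ → ℂ) (D : Set ℂ) : Prop where
  subset : D ⊆ {z : ℂ | z.im ≠ 0}
  isOpen : IsOpen D
  discrete_compl : DiscreteTopology ↥({z : ℂ | z.im ≠ 0} \ D)
  holo : DifferentiableOn ℂ Q D
  conj_mem : ∀ z ∈ D, (starRingEnd ℂ) z ∈ D
  symm : ∀ z ∈ D, Q ((starRingEnd ℂ) z) = (starRingEnd ℂ) (Q z)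
  le_one : ∀ (n : ℕ) (z : Fin n → ℂ), (∀ i, z i ∈ D ∧ 0 < (z i).im) →
    negEigCount (nevKernel Q z) ≤ 1
  exists_one : ∃ (n : ℕ) (z : Fin n → ℂ), (∀ i, z i ∈ D ∧ 0 < (z i).im) ∧
    negEigCount (nevKernel Q z) = 1

/-- A Nevanlinna function. -/
structure IsNevanlinna (M : ℂ → ℂ) : Prop where
  holo : DifferentiableOn ℂ M {z : ℂ | z.im ≠ 0}
  symm : ∀ z : ℂ, z.im ≠ 0 → M ((starRingEnd ℂ) z) = (starRingEnd ℂ) (M z)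
  im_nonneg : ∀ z : ℂ, 0 < z.im → 0 ≤ (M z).im

section IndefiniteForm

variable {V : Type*} [AddCommGroup V] [Module ℂ V] {B : V →ₗ⋆[ℂ] V →ₗ[ℂ] ℂ}

/-- If all eigenvectors of an operator that is symmetric for a Hermitian form are positive, then
the form is positive definite on every invariant subspace. -/
theorem form_pos_of_eigenvector_pos [FiniteDimensional ℂ V]
    (hB : ∀ x y, (starRingEnd ℂ) (B x y) = B y x) (A : V →ₗ[ℂ] V)
    (hA : ∀ x y, B (A x) y = B x (A y))
    (hpos : ∀ (μ : ℂ) (u : V), u ≠ 0 → A u = μ • u → 0 < (B u u).re) (n : ℕ) :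
    ∀ W : Submodule ℂ V, Module.finrank ℂ W = n → (∀ x ∈ W, A x ∈ W) →
      ∀ x ∈ W, x ≠ 0 → 0 < (B x x).re := by
  induction n using Nat.strong_induction_on with
  | _ n ih =>
    intro W hW hAW x hx hx0
    have : Nontrivial W := ⟨⟨⟨x, hx⟩, 0, fun h => hx0 (congrArg Subtype.val h)⟩⟩
    obtain ⟨μ, hμ⟩ := Module.End.exists_eigenvalue (A.restrict hAW)
    obtain ⟨⟨u, huW⟩, hu⟩ := hμ.exists_hasEigenvector
    have hu0 : u ≠ 0 := fun h => hu.2 (Subtype.ext h)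
    have hAu : A u = μ • u := congrArg Subtype.val hu.apply_eq_smul
    have hup := hpos μ u hu0 hAu
    have huu : B u u ≠ 0 := fun h => by simp [h] at hup
    have hlt : Module.finrank ℂ (W ⊓ LinearMap.ker (B u) : Submodule ℂ V) < n := by
      rw [← hW]
      refine Submodule.finrank_lt_finrank_of_lt (lt_of_le_of_ne inf_le_left fun h => huu ?_)
      have : u ∈ W ⊓ LinearMap.ker (B u) := by rw [h]; exact huW
      exact this.2
    have key := ih _ hlt (W ⊓ LinearMap.ker (B u)) rfl (by
      rintro y ⟨hy, hy'⟩
      refine ⟨hAW y hy, ?_⟩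
      have hy0 : B u y = 0 := hy'
      change B u (A y) = 0
      rw [← hA, hAu]
      simp [hy0])
    set c : ℂ := B u x / B u u with hc
    have hv : B u (x - c • u) = 0 := by simp [hc, huu]
    have hv' : B (x - c • u) u = 0 := by rw [← hB, hv, map_zero]
    have hvW : x - c • u ∈ W ⊓ LinearMap.ker (B u) :=
      ⟨W.sub_mem hx (W.smul_mem c huW), hv⟩
    have hxe : B x x = B (x - c • u) (x - c • u) + (starRingEnd ℂ) c * c * B u u := by
      conv_lhs => rw [show x = (x - c • u) + c • u by abel]
      simp only [map_add, LinearMap.add_apply, LinearMap.map_smulₛₗ, LinearMap.smul_apply,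
        map_smul, smul_eq_mul, hv, hv']
      ring
    have hcc : (starRingEnd ℂ) c * c = ((normSq c : ℝ) : ℂ) := by rw [mul_comm, mul_conj]
    rw [hxe, hcc, add_re, re_ofReal_mul]
    rcases eq_or_ne (x - c • u) 0 with h0 | h0
    · have hc0 : c ≠ 0 := by
        rintro h
        rw [h, zero_smul, sub_zero] at h0
        exact hx0 h0
      have := mul_pos (normSq_pos.2 hc0) hup
      simpa [h0] using this
    · have := key _ hvW h0
      have := mul_nonneg (normSq_nonneg c) hup.le
      linarith

/-- A symmetric operator for an indefinite nondegenerate Hermitian form has a nonpositive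
eigenvector whose eigenvalue lies in the closed lower half-plane. -/
theorem exists_nonpos_eigenvector [FiniteDimensional ℂ V]
    (hB : ∀ x y, (starRingEnd ℂ) (B x y) = B y x)
    (hnd : ∀ x, (∀ y, B y x = 0) → x = 0) (hneg : ∃ x, (B x x).re < 0) (A : V →ₗ[ℂ] V)
    (hA : ∀ x y, B (A x) y = B x (A y)) :
    ∃ (μ : ℂ) (u : V), u ≠ 0 ∧ A u = μ • u ∧ (B u u).re ≤ 0 ∧ μ.im ≤ 0 := by
  have h : ∃ (μ : ℂ) (u : V), u ≠ 0 ∧ A u = μ • u ∧ (B u u).re ≤ 0 := by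
    by_contra! h
    obtain ⟨x, hx⟩ := hneg
    have := form_pos_of_eigenvector_pos hB A hA h _ ⊤ rfl (by simp) x (by simp)
      (by rintro rfl; simp at hx)
    linarith
  obtain ⟨μ, u, hu0, hu, hneg⟩ := h
  by_cases hμ : μ.im ≤ 0
  · exact ⟨μ, u, hu0, hu, hneg, hμ⟩
  have hT2n : ¬ Function.Injective (A - (starRingEnd ℂ) μ • LinearMap.id : V →ₗ[ℂ] V) := by
    intro hi
    have hs := LinearMap.injective_iff_surjective.1 hi
    refine hu0 (hnd u fun y => ?_)
    obtain ⟨x, rfl⟩ := hs y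
    simp [hA, hu]
  obtain ⟨v, hv, hv0⟩ : ∃ v, (A - (starRingEnd ℂ) μ • LinearMap.id : V →ₗ[ℂ] V) v = 0 ∧ v ≠ 0 := by
    by_contra! h
    exact hT2n ((injective_iff_map_eq_zero _).2 h)
  have hv : A v = (starRingEnd ℂ) μ • v := by simpa [sub_eq_zero] using hv
  refine ⟨_, v, hv0, hv, ?_, by simp at hμ ⊢; exact hμ.le⟩
  have h1 := hA v v
  rw [hv] at h1
  simp only [LinearMap.map_smulₛₗ, LinearMap.smul_apply, map_smul, smul_eq_mul, conj_conj] at h1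
  rw [← sub_eq_zero, ← sub_mul, sub_conj] at h1
  rcases mul_eq_zero.1 h1 with h2 | h2
  · simp at h2; exact absurd h2.le hμ
  · simp [h2]

/-- If a Hermitian form is positive definite on a hyperplane, then it is nonnegative on the
orthogonal complement of every nonzero nonpositive vector. -/
theorem form_nonneg_of_orthogonal_nonpos
    (hB : ∀ x y, (starRingEnd ℂ) (B x y) = B y x) (l : V →ₗ[ℂ] ℂ)
    (hl : ∀ x, x ≠ 0 → l x = 0 → 0 < (B x x).re) {u f : V} (hu0 : u ≠ 0)
    (hu : (B u u).re ≤ 0) (huf : B u f = 0) : 0 ≤ (B f f).re := by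
  by_contra! hf
  have hfu : B f u = 0 := by rw [← hB, huf, map_zero]
  have hf0 : f ≠ 0 := by rintro rfl; simp at hf
  have hlf : l f ≠ 0 := fun h => by linarith [hl f hf0 h]
  have hg : l f • u - l u • f = 0 := by
    by_contra h0
    have h1 := hl _ h0 (by simp [mul_comm])
    have h2 : B (l f • u - l u • f) (l f • u - l u • f) =
        ((normSq (l f) : ℝ) : ℂ) * B u u + ((normSq (l u) : ℝ) : ℂ) * B f f := by
      simp only [map_sub, LinearMap.sub_apply, LinearMap.map_smulₛₗ, LinearMap.smul_apply,
        map_smul, smul_eq_mul, huf, hfu, ← mul_conj]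
      ring
    rw [h2, add_re, re_ofReal_mul, re_ofReal_mul] at h1
    nlinarith [normSq_nonneg (l f), normSq_nonneg (l u)]
  have h3 : B f (l f • u - l u • f) = 0 := by rw [hg, map_zero]
  have h4 : l u * B f f = 0 := by simpa [hfu] using h3
  rcases mul_eq_zero.1 h4 with h | h
  · rw [h, zero_smul, sub_zero] at hg
    exact hu0 ((smul_eq_zero.1 hg).resolve_left hlf)
  · simp [h] at hf

end IndefiniteForm

theorem im_mul_quadratic_identity (z w α β : ℂ) :
    (w * ((z - β) * (z - (starRingEnd ℂ) β)) *
        (starRingEnd ℂ) ((z - α) * (z - (starRingEnd ℂ) α))).im =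
      normSq (z - α) * normSq (z - β) * w.im -
        2 * z.im * ((z - β) * (α - (starRingEnd ℂ) β) * w * (starRingEnd ℂ) (z - α)).re := by
  simp only [normSq_apply, map_mul, map_sub, mul_re, mul_im, sub_re, sub_im, conj_re, conj_im,
    conj_conj]
  ring

/-- Interpolation data whose Pick form is nondegenerate and has one negative square is
generated, up to a quotient of two nonnegative quadratics, by values with nonnegative imaginary
part. -/
theorem exists_quadratics_of_form {V ι : Type*} [AddCommGroup V] [Module ℂ V] [Fintype ι]
    {B : V →ₗ⋆[ℂ] V →ₗ[ℂ] ℂ} (e : Module.Basis ι ℂ V)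
    (hB : ∀ x y, (starRingEnd ℂ) (B x y) = B y x)
    (hnd : ∀ x, (∀ y, B y x = 0) → x = 0) (hneg : ∃ x, (B x x).re < 0)
    (l : V →ₗ[ℂ] ℂ) (hl : ∀ x, x ≠ 0 → l x = 0 → 0 < (B x x).re)
    (z w : ι → ℂ) (hz : ∀ i, 0 < (z i).im)
    (he : ∀ i j, B (e i) (e j) * (z i - (starRingEnd ℂ) (z j)) = w i - (starRingEnd ℂ) (w j)) :
    ∃ α β : ℂ, ∀ i, 0 ≤ (w i * ((z i - β) * (z i - (starRingEnd ℂ) β)) *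
        (starRingEnd ℂ) ((z i - α) * (z i - (starRingEnd ℂ) α))).im := by
  classical
  have : FiniteDimensional ℂ V := e.finiteDimensional_of_finite
  have hnd' : ∀ x, (∀ i, B (e i) x = 0) → x = 0 := by
    intro x hx
    refine hnd x fun y => ?_
    have : B.flip x = 0 := e.ext fun i => by simpa using hx i
    simpa using LinearMap.congr_fun this y
  obtain ⟨k, hk⟩ : ∃ k, ∀ i, B (e i) k = w i + 1 := by
    have hinj : Function.Injective (LinearMap.pi fun i => B (e i) : V →ₗ[ℂ] ι → ℂ) := by
      refine (injective_iff_map_eq_zero _).2 fun x hx => hnd' x fun i => ?_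
      simpa using congrFun hx i
    have hs := (LinearMap.injective_iff_surjective_of_finrank_eq_finrank
      (by simp [Module.finrank_eq_card_basis e])).1 hinj
    obtain ⟨k, hk⟩ := hs fun i => w i + 1
    exact ⟨k, fun i => by simpa using congrFun hk i⟩
  have hk' : ∀ i, B k (e i) = (starRingEnd ℂ) (w i) + 1 := fun i => by rw [← hB, hk]; simp
  set A : V →ₗ[ℂ] V := e.constr ℂ fun i => (starRingEnd ℂ) (z i) • e i + k with hAdef
  have hAe : ∀ i, A (e i) = (starRingEnd ℂ) (z i) • e i + k := fun i => by
    rw [hAdef, Module.Basis.constr_basis]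
  have hA : ∀ x y, B (A x) y = B x (A y) := by
    have : B.comp A = B.compl₂ A := by
      refine LinearMap.ext_basis e e fun i j => ?_
      simp only [LinearMap.comp_apply, LinearMap.compl₂_apply, hAe, map_add, LinearMap.map_smulₛₗ,
        map_smul, LinearMap.add_apply, LinearMap.smul_apply, smul_eq_mul, conj_conj, hk, hk']
      linear_combination he i j
    intro x y
    exact LinearMap.congr_fun (LinearMap.congr_fun this x) y
  set C : V →ₗ[ℂ] V := A - (B k).smulRight k with hCdef
  have hCx : ∀ x, C x = A x - B k x • k := fun x => by simp [hCdef]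
  have hC : ∀ x y, B (C x) y = B x (C y) := by
    intro x y
    simp only [hCx, map_sub, LinearMap.sub_apply, LinearMap.map_smulₛₗ, map_smul,
      LinearMap.smul_apply, smul_eq_mul, hA, hB]
    ring
  obtain ⟨β, u, hu0, hu, hun, -⟩ := exists_nonpos_eigenvector hB hnd hneg A hA
  obtain ⟨α, v, hv0, hv, hvn, hαim⟩ := exists_nonpos_eigenvector hB hnd hneg C hC
  have hzα : ∀ i, z i - α ≠ 0 := fun i h => by
    have h1 := congrArg im h
    have h2 := hz i
    simp at h1
    linarith
  have hev : ∀ i, (z i - α) * B (e i) v = w i * B k v := fun i => by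
    have h1 := hC (e i) v
    rw [hv, hCx, hAe, hk'] at h1
    simp only [map_sub, map_add, LinearMap.sub_apply, LinearMap.add_apply, LinearMap.map_smulₛₗ,
      map_smul, LinearMap.smul_apply, smul_eq_mul, conj_conj, map_one] at h1
    linear_combination h1
  have hκ : B k v ≠ 0 := fun h => hv0 (hnd' v fun i => by
    have := hev i
    rw [h, mul_zero] at this
    exact (mul_eq_zero.1 this).resolve_left (hzα i))
  have huv : ((starRingEnd ℂ) β - α) * B u v = B k v * B u k := by
    have h1 := hA u v
    have h2 : A v = α • v + B k v • k := by rw [← hv, hCx]; abel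
    rw [h2, hu] at h1
    simp only [map_add, LinearMap.map_smulₛₗ, map_smul, LinearMap.smul_apply, smul_eq_mul] at h1
    linear_combination h1
  refine ⟨α, β, fun i => ?_⟩
  have hue : ((starRingEnd ℂ) β - (starRingEnd ℂ) (z i)) * B u (e i) = B u k := by
    have h1 := hA u (e i)
    rw [hAe, hu] at h1
    simp only [map_add, LinearMap.map_smulₛₗ, map_smul, LinearMap.smul_apply, smul_eq_mul] at h1
    linear_combination h1
  have hf := form_nonneg_of_orthogonal_nonpos hB l hl hu0 hun
    (f := (((starRingEnd ℂ) β - (starRingEnd ℂ) (z i)) * B k v) • e i -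
      ((starRingEnd ℂ) β - α) • v) (by
      simp only [map_sub, map_smul, smul_eq_mul]
      linear_combination B k v * hue - huv)
  have hve : B v (e i) = (starRingEnd ℂ) (B (e i) v) := (hB _ _).symm
  have hff : normSq (z i - α) *
      (B ((((starRingEnd ℂ) β - (starRingEnd ℂ) (z i)) * B k v) • e i -
      ((starRingEnd ℂ) β - α) • v) ((((starRingEnd ℂ) β - (starRingEnd ℂ) (z i)) * B k v) • e i -
      ((starRingEnd ℂ) β - α) • v)).re * (z i).im =
      normSq (B k v) * (w i * ((z i - β) * (z i - (starRingEnd ℂ) β)) *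
        (starRingEnd ℂ) ((z i - α) * (z i - (starRingEnd ℂ) α))).im +
      normSq (z i - α) * normSq ((starRingEnd ℂ) β - α) * (B v v).re * (z i).im := by
    have hE : (B (e i) (e i)).re * (z i).im = (w i).im := by
      have h1 := congrArg im (he i i)
      rw [sub_conj, sub_conj, mul_im] at h1
      simp at h1
      linarith
    have hX : ((normSq (z i - α) : ℝ) : ℂ) * B (e i) v =
        (starRingEnd ℂ) (z i - α) * (w i * B k v) := by
      rw [← hev i, ← mul_conj]
      ring
    set a : ℂ := ((starRingEnd ℂ) β - (starRingEnd ℂ) (z i)) * B k v with ha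
    set b : ℂ := (starRingEnd ℂ) β - α with hb
    have hform : B (a • e i - b • v) (a • e i - b • v) =
        ((normSq a : ℝ) : ℂ) * B (e i) (e i) + ((normSq b : ℝ) : ℂ) * B v v -
          ((starRingEnd ℂ) a * b * B (e i) v +
            (starRingEnd ℂ) ((starRingEnd ℂ) a * b * B (e i) v)) := by
      simp only [map_sub, map_mul, LinearMap.sub_apply, LinearMap.map_smulₛₗ, map_smul,
        LinearMap.smul_apply, smul_eq_mul, hve, ← mul_conj, conj_conj]
      ring
    have hcross : ((normSq (z i - α) : ℝ) : ℂ) * ((starRingEnd ℂ) a * b * B (e i) v) =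
        ((normSq (B k v) : ℝ) : ℂ) * ((z i - β) * (α - (starRingEnd ℂ) β) * w i *
          (starRingEnd ℂ) (z i - α)) := by
      calc _ = (starRingEnd ℂ) a * b * (((normSq (z i - α) : ℝ) : ℂ) * B (e i) v) := by ring
        _ = _ := by
          rw [hX, ← mul_conj, ha, hb]
          simp only [map_mul, map_sub, conj_conj]
          ring
    have hcross' := congrArg re hcross
    rw [re_ofReal_mul, re_ofReal_mul] at hcross'
    have hna : normSq a = normSq (z i - β) * normSq (B k v) := by
      rw [ha, normSq_mul, ← map_sub, normSq_conj, ← normSq_neg, neg_sub]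
    rw [im_mul_quadratic_identity, hform, sub_re, add_re, add_re, conj_re, re_ofReal_mul,
      re_ofReal_mul, hna]
    linear_combination normSq (z i - α) * normSq (z i - β) * normSq (B k v) * hE -
      2 * (z i).im * hcross'
  have h1 : 0 ≤ normSq (B k v) * (w i * ((z i - β) * (z i - (starRingEnd ℂ) β)) *
        (starRingEnd ℂ) ((z i - α) * (z i - (starRingEnd ℂ) α))).im := by
    have h2 := mul_nonneg (mul_nonneg (normSq_nonneg (z i - α)) hf) (hz i).le
    have h3 := mul_nonneg (mul_nonneg (mul_nonneg (normSq_nonneg (z i - α))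
      (normSq_nonneg ((starRingEnd ℂ) β - α))) (neg_nonneg.2 hvn)) (hz i).le
    linarith
  exact nonneg_of_mul_nonneg_right h1 (normSq_pos.2 hκ)

/-- The Pick matrix of the interpolation data `z i ↦ w i`. -/
noncomputable def pickMatrix {ι : Type*} (z w : ι → ℂ) : Matrix ι ι ℂ :=
  Matrix.of fun i j => (w i - (starRingEnd ℂ) (w j)) / (z i - (starRingEnd ℂ) (z j))

/-- The Hermitian form of the Pick matrix. -/
noncomputable def pickForm {n : ℕ} (z w : Fin n → ℂ) :
    (Fin n → ℂ) →ₗ⋆[ℂ] (Fin n → ℂ) →ₗ[ℂ] ℂ :=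
  Matrix.toLinearMapₛₗ₂' ℂ (starRingEnd ℂ) (RingHom.id ℂ) (pickMatrix z w)

theorem pickForm_apply {n : ℕ} (z w x y : Fin n → ℂ) :
    pickForm z w x y = ∑ i, ∑ j, (starRingEnd ℂ) (x i) * y j *
      ((w i - (starRingEnd ℂ) (w j)) / (z i - (starRingEnd ℂ) (z j))) := by
  simp [pickForm, Matrix.toLinearMapₛₗ₂'_apply, pickMatrix, mul_assoc]

theorem pickForm_conj {n : ℕ} (z w x y : Fin n → ℂ) :
    (starRingEnd ℂ) (pickForm z w x y) = pickForm z w y x := by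
  rw [pickForm_apply, pickForm_apply, Finset.sum_comm]
  simp only [map_sum, map_mul, map_div₀, map_sub, conj_conj]
  refine Finset.sum_congr rfl fun i _ => Finset.sum_congr rfl fun j _ => ?_
  rw [← neg_sub (w i), ← neg_sub (z i), neg_div_neg_eq]
  ring

theorem pickForm_add_smul {n : ℕ} (z w m x y : Fin n → ℂ) (ε : ℝ) :
    pickForm z (fun i => w i + ε * m i) x y = pickForm z w x y + ε * pickForm z m x y := by
  simp only [pickForm_apply, Finset.mul_sum, ← Finset.sum_add_distrib]
  refine Finset.sum_congr rfl fun i _ => Finset.sum_congr rfl fun j _ => ?_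
  simp only [map_add, map_mul, conj_ofReal]
  ring

theorem sub_conj_ne_zero {z w : ℂ} (hz : 0 < z.im) (hw : 0 < w.im) :
    z - (starRingEnd ℂ) w ≠ 0 := fun h => by
  have := congrArg im h
  simp at this
  linarith

theorem natCast_sub_ne_zero {z : ℂ} (hz : 0 < z.im) (k : ℕ) : (k : ℂ) - z ≠ 0 := fun h => by
  have := congrArg im h
  simp at this
  linarith

/-- The columns of a Cauchy matrix are linearly independent. -/
theorem eq_zero_of_cauchy_sum_eq_zero {n : ℕ} {z c : Fin n → ℂ} (hz : ∀ i, 0 < (z i).im)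
    (hinj : Function.Injective z) (h : ∀ k : Fin n, ∑ i, c i / ((k : ℕ) - z i) = 0) : c = 0 := by
  open Polynomial in
  set p : ℂ[X] := ∑ i, C (c i) * ∏ j ∈ Finset.univ.erase i, (X - C (z j)) with hp
  have hdeg : ∀ i, (C (c i) * ∏ j ∈ Finset.univ.erase i, (X - C (z j))).degree < (n : ℕ) := by
    intro i
    have hn : 0 < n := i.pos
    refine lt_of_le_of_lt (degree_mul_le_of_le degree_C_le le_rfl) ?_
    rw [degree_prod, zero_add]
    simp only [degree_X_sub_C, Finset.sum_const, Finset.card_erase_of_mem (Finset.mem_univ i),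
      Finset.card_univ, Fintype.card_fin, nsmul_eq_mul, mul_one]
    exact_mod_cast Nat.sub_lt hn one_pos
  have hroot : ∀ k : Fin n, p.eval ((k : ℕ) : ℂ) = 0 := by
    intro k
    have h1 : p.eval ((k : ℕ) : ℂ) =
        (∏ j, (((k : ℕ) : ℂ) - z j)) * ∑ i, c i / ((k : ℕ) - z i) := by
      rw [hp, eval_finsetSum, Finset.mul_sum]
      refine Finset.sum_congr rfl fun i _ => ?_
      rw [← Finset.mul_prod_erase _ _ (Finset.mem_univ i)]
      have := natCast_sub_ne_zero (hz i) k
      simp only [eval_mul, eval_C, eval_prod, eval_sub, eval_X]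
      field_simp
    rw [h1, h k, mul_zero]
  have hp0 : p = 0 := by
    refine eq_zero_of_degree_lt_of_eval_index_eq_zero (s := Finset.univ)
      (v := fun k : Fin n => ((k : ℕ) : ℂ)) ?_ ?_ (fun k _ => hroot k)
    · intro a _ b _ hab
      exact Fin.ext (Nat.cast_injective (R := ℂ) hab)
    · refine (degree_sum_le _ _).trans_lt ((Finset.sup_lt_iff ?_).2 fun i _ => ?_)
      · exact WithBot.bot_lt_coe _
      · simpa using hdeg i
  funext i
  have h2 : p.eval (z i) = c i * ∏ j ∈ Finset.univ.erase i, (z i - z j) := by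
    rw [hp, eval_finsetSum, Finset.sum_eq_single i]
    · simp [eval_prod]
    · intro j _ hji
      rw [eval_mul, eval_prod, Finset.prod_eq_zero (i := i)]
      · simp
      · simp [hji.symm]
      · simp
    · simp
  rw [hp0, eval_zero] at h2
  refine (mul_eq_zero.1 h2.symm).resolve_right (Finset.prod_ne_zero_iff.2 fun j hj => ?_)
  rw [sub_ne_zero]
  exact fun h => (Finset.mem_erase.1 hj).1 (hinj h).symm

/-- The values of a rational Nevanlinna function of degree `n` have a positive definite Pick
form at `n` distinct points. -/
theorem pickForm_cauchy_pos {n : ℕ} {z : Fin n → ℂ} (hz : ∀ i, 0 < (z i).im)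
    (hinj : Function.Injective z) {x : Fin n → ℂ} (hx : x ≠ 0) :
    0 < (pickForm z (fun i => ∑ k : Fin n, 1 / ((k : ℕ) - z i)) x x).re := by
  have h1 : pickForm z (fun i => ∑ k : Fin n, 1 / ((k : ℕ) - z i)) x x =
      ((∑ k : Fin n, normSq (∑ i, (starRingEnd ℂ) (x i) / ((k : ℕ) - z i)) : ℝ) : ℂ) := by
    rw [pickForm_apply, ofReal_sum]
    simp only [← mul_conj, map_sum, Finset.sum_mul_sum]
    rw [eq_comm, Finset.sum_comm]
    refine Finset.sum_congr rfl fun i _ => ?_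
    rw [Finset.sum_comm]
    refine Finset.sum_congr rfl fun j _ => ?_
    rw [← Finset.sum_sub_distrib, Finset.sum_div, Finset.mul_sum]
    refine Finset.sum_congr rfl fun k _ => ?_
    have hi := natCast_sub_ne_zero (hz i) k
    have hj : (k : ℂ) - (starRingEnd ℂ) (z j) ≠ 0 := by
      have := (map_ne_zero (starRingEnd ℂ)).2 (natCast_sub_ne_zero (hz j) k)
      simpa using this
    have hij := sub_conj_ne_zero (hz i) (hz j)
    simp only [map_div₀, map_one, map_sub, map_natCast, conj_conj]
    field_simp
    ring
  rw [h1, ofReal_re]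
  refine lt_of_le_of_ne (Finset.sum_nonneg fun k _ => normSq_nonneg _) fun h => hx ?_
  have h2 := (Finset.sum_eq_zero_iff_of_nonneg fun k _ => normSq_nonneg _).1 h.symm
  have h3 := eq_zero_of_cauchy_sum_eq_zero hz hinj
    (fun k => normSq_eq_zero.1 (h2 k (Finset.mem_univ k)))
  funext i
  simpa using congrFun h3 i

theorem pickForm_eq_dotProduct {n : ℕ} (z w x : Fin n → ℂ) :
    pickForm z w x x = star x ⬝ᵥ (pickMatrix z w).mulVec x := by
  rw [pickForm_apply]
  simp only [dotProduct, Matrix.mulVec, pickMatrix, Matrix.of_apply, Finset.mul_sum, Pi.star_apply,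
    RCLike.star_def]
  refine Finset.sum_congr rfl fun i _ => Finset.sum_congr rfl fun j _ => ?_
  ring

theorem pickMatrix_isHermitian {ι : Type*} (z w : ι → ℂ) : (pickMatrix z w).IsHermitian := by
  refine Matrix.IsHermitian.ext fun i j => ?_
  simp only [pickMatrix, Matrix.of_apply, RCLike.star_def, map_div₀, map_sub, conj_conj]
  rw [← neg_sub (w i), ← neg_sub (z i), neg_div_neg_eq]

theorem dotProduct_mulVec_eq_sum_eigenvalues {n : ℕ} {A : Matrix (Fin n) (Fin n) ℂ}
    (hA : A.IsHermitian) (x : Fin n → ℂ) :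
    star x ⬝ᵥ A.mulVec x = ((∑ i, hA.eigenvalues i *
      normSq (inner ℂ (hA.eigenvectorBasis i) (WithLp.toLp 2 x)) : ℝ) : ℂ) := by
  have h1 : star x ⬝ᵥ A.mulVec x = inner ℂ (WithLp.toLp 2 x) (WithLp.toLp 2 (A.mulVec x)) := by
    rw [EuclideanSpace.inner_eq_star_dotProduct, dotProduct_comm]
  rw [h1, ← hA.eigenvectorBasis.sum_inner_mul_inner, ofReal_sum]
  refine Finset.sum_congr rfl fun i _ => ?_
  have h2 : inner ℂ (hA.eigenvectorBasis i) (WithLp.toLp 2 (A.mulVec x)) =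
      hA.eigenvalues i * inner ℂ (hA.eigenvectorBasis i) (WithLp.toLp 2 x) := by
    have h3 := Matrix.isSymmetric_toEuclideanLin_iff.mpr hA (hA.eigenvectorBasis i)
      (WithLp.toLp 2 x)
    have h4 : Matrix.toEuclideanLin A (hA.eigenvectorBasis i) =
        (hA.eigenvalues i : ℂ) • hA.eigenvectorBasis i := by
      have := hA.mulVec_eigenvectorBasis i
      ext j
      simpa [Matrix.toLpLin_apply] using congrFun this j
    rw [h4, inner_smul_left, conj_ofReal] at h3
    rw [h3]
    simp
  rw [h2, ← inner_conj_symm, ofReal_mul, ← mul_conj]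
  ring

theorem exists_linear_of_negEigCount_le_one {n : ℕ} {A : Matrix (Fin n) (Fin n) ℂ}
    (hA : A.IsHermitian) (h : negEigCount A ≤ 1) :
    ∃ l : (Fin n → ℂ) →ₗ[ℂ] ℂ, ∀ x, l x = 0 → 0 ≤ (star x ⬝ᵥ A.mulVec x).re := by
  rw [negEigCount, dif_pos hA, Finset.card_le_one] at h
  simp only [Finset.mem_filter, Finset.mem_univ, true_and] at h
  by_cases hneg : ∃ i, hA.eigenvalues i < 0
  · obtain ⟨i, hi⟩ := hneg
    refine ⟨(innerₛₗ ℂ (hA.eigenvectorBasis i)).comp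
      (WithLp.linearEquiv 2 ℂ (Fin n → ℂ)).symm.toLinearMap, fun x hx => ?_⟩
    rw [dotProduct_mulVec_eq_sum_eigenvalues hA, ofReal_re]
    refine Finset.sum_nonneg fun j _ => ?_
    by_cases hj : hA.eigenvalues j < 0
    · have hx' : inner ℂ (hA.eigenvectorBasis i) (WithLp.toLp 2 x) = 0 := hx
      rw [h j hj i hi, hx']
      simp
    · exact mul_nonneg (not_lt.1 hj) (normSq_nonneg _)
  · push Not at hneg
    refine ⟨0, fun x _ => ?_⟩
    rw [dotProduct_mulVec_eq_sum_eigenvalues hA, ofReal_re]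
    exact Finset.sum_nonneg fun j _ => mul_nonneg (hneg j) (normSq_nonneg _)

theorem negEigCount_eq_zero {n : ℕ} {A : Matrix (Fin n) (Fin n) ℂ}
    (h : ∀ x, 0 ≤ (star x ⬝ᵥ A.mulVec x).re) : negEigCount A = 0 := by
  rw [negEigCount]
  split_ifs with hA
  · rw [Finset.card_eq_zero, Finset.filter_eq_empty_iff]
    intro i _
    have := h (hA.eigenvectorBasis i)
    rw [dotProduct_mulVec_eq_sum_eigenvalues hA, ofReal_re] at this
    simpa [OrthonormalBasis.inner_eq_ite] using this
  · rfl

/-- The real quadratic polynomial `(a X - b) (ā X - b̄)`. -/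
noncomputable def realQuad (t : ℂ × ℂ) (z : ℂ) : ℂ :=
  (t.1 * z - t.2) * ((starRingEnd ℂ) t.1 * z - (starRingEnd ℂ) t.2)

/-- Normalized parameters for `realQuad`. -/
def quadParams : Set (ℂ × ℂ) := {t | normSq t.1 + normSq t.2 = 1}

theorem isCompact_quadParams : IsCompact quadParams := by
  refine Metric.isCompact_of_isClosed_isBounded ?_ ?_
  · refine isClosed_eq ?_ continuous_const
    exact (continuous_normSq.comp continuous_fst).add (continuous_normSq.comp continuous_snd)
  · refine (Metric.isBounded_closedBall (x := (0 : ℂ × ℂ)) (r := 1)).subset fun t ht => ?_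
    have ht : normSq t.1 + normSq t.2 = 1 := ht
    rw [normSq_eq_norm_sq, normSq_eq_norm_sq] at ht
    rw [mem_closedBall_zero_iff, Prod.norm_def, max_le_iff]
    constructor <;> nlinarith [norm_nonneg t.1, norm_nonneg t.2, sq_nonneg ‖t.1‖, sq_nonneg ‖t.2‖]

@[fun_prop]
theorem continuous_realQuad (z : ℂ) : Continuous fun t => realQuad t z := by
  unfold realQuad
  fun_prop

theorem exists_quadParams (α : ℂ) : ∃ t ∈ quadParams, ∃ c : ℝ, 0 ≤ c ∧
    ∀ z, realQuad t z = c * ((z - α) * (z - (starRingEnd ℂ) α)) := by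
  have h1 : 0 < 1 + normSq α := by linarith [normSq_nonneg α]
  set s : ℝ := (√(1 + normSq α))⁻¹ with hs
  have hss : s * s = (1 + normSq α)⁻¹ := by
    rw [hs, ← mul_inv, Real.mul_self_sqrt h1.le]
  refine ⟨(s, s * α), ?_, s * s, mul_self_nonneg s, fun z => ?_⟩
  · change normSq (s : ℂ) + normSq (s * α) = 1
    rw [normSq_mul, normSq_ofReal, hss]
    field_simp
  · simp only [realQuad, map_mul, conj_ofReal]
    push_cast
    ring

/-- Interpolation data whose Pick form is nonnegative on a hyperplane is generated, up to a
quotient of two nonnegative quadratics, by values with nonnegative imaginary part. -/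
theorem exists_quadParams_of_pickForm {n : ℕ} {z w : Fin n → ℂ} (hz : ∀ i, 0 < (z i).im)
    (hinj : Function.Injective z) (l : (Fin n → ℂ) →ₗ[ℂ] ℂ)
    (hl : ∀ x, l x = 0 → 0 ≤ (pickForm z w x x).re) :
    ∃ t ∈ quadParams ×ˢ quadParams,
      ∀ i, 0 ≤ (w i * realQuad t.2 (z i) * (starRingEnd ℂ) (realQuad t.1 (z i))).im := by
  set m : Fin n → ℂ := fun i => ∑ k : Fin n, 1 / ((k : ℕ) - z i) with hm
  have hstrict : ∀ ε : ℝ, 0 < ε → ∃ t ∈ quadParams ×ˢ quadParams,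
      ∀ i, 0 ≤ ((w i + ε * m i) * realQuad t.2 (z i) *
        (starRingEnd ℂ) (realQuad t.1 (z i))).im := by
    intro ε hε
    set B := pickForm z (fun i => w i + ε * m i) with hBdef
    have hB : ∀ x y, (starRingEnd ℂ) (B x y) = B y x := fun x y => pickForm_conj _ _ x y
    have hBl : ∀ x, x ≠ 0 → l x = 0 → 0 < (B x x).re := by
      intro x hx hlx
      rw [hBdef, pickForm_add_smul, add_re, re_ofReal_mul]
      have h1 := hl x hlx
      have h2 := mul_pos hε (pickForm_cauchy_pos hz hinj hx)
      linarith
    have hBe : ∀ i j, B (Pi.single i 1) (Pi.single j 1) * (z i - (starRingEnd ℂ) (z j)) =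
        (w i + ε * m i) - (starRingEnd ℂ) (w j + ε * m j) := by
      intro i j
      rw [hBdef, pickForm, Matrix.toLinearMapₛₗ₂'_single, pickMatrix, Matrix.of_apply,
        div_mul_cancel₀ _ (sub_conj_ne_zero (hz i) (hz j))]
    by_cases hneg : ∃ x, (B x x).re < 0
    · have hnd : ∀ x, (∀ y, B y x = 0) → x = 0 := by
        intro x hx
        by_contra hx0
        have hlx : l x ≠ 0 := fun h => by
          have := hBl x hx0 h
          simp [hx x] at this
        obtain ⟨y, hy⟩ := hneg
        have hxy : ∀ y, B x y = 0 := fun y => by rw [← hB, hx, map_zero]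
        set g := y - (l y / l x) • x with hg
        have hBg : B g g = B y y := by
          simp [hg, hx, hxy]
        have hlg : l g = 0 := by simp [hg, hlx]
        rcases eq_or_ne g 0 with h0 | h0
        · rw [h0] at hBg
          simp [← hBg] at hy
        · have := hBl g h0 hlg
          rw [hBg] at this
          linarith
      obtain ⟨α, β, hαβ⟩ := exists_quadratics_of_form (Pi.basisFun ℂ (Fin n)) hB hnd hneg l hBl z
        (fun i => w i + ε * m i) hz (fun i j => by simpa using hBe i j)
      obtain ⟨t, ht, c, hc, htc⟩ := exists_quadParams α
      obtain ⟨s, hs, d, hd, hsd⟩ := exists_quadParams β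
      refine ⟨(t, s), ⟨ht, hs⟩, fun i => ?_⟩
      have h1 := mul_nonneg (mul_nonneg hc hd) (hαβ i)
      rw [← im_ofReal_mul] at h1
      refine h1.trans_eq (congrArg im ?_)
      simp only [htc, hsd, map_mul, conj_ofReal]
      push_cast
      ring
    · push Not at hneg
      refine ⟨((0, 1), (0, 1)), ⟨by simp [quadParams], by simp [quadParams]⟩, fun i => ?_⟩
      have h1 := hneg (Pi.single i 1)
      have h2 := congrArg im (hBe i i)
      rw [sub_conj, sub_conj, mul_I_im, ofReal_re, ← mul_assoc, mul_I_im, re_mul_ofReal] at h2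
      have h3 : 0 ≤ (w i + ε * m i).im := by nlinarith [hz i]
      simpa [realQuad] using h3
  choose t ht htp using fun N : ℕ => hstrict (1 / ((N : ℝ) + 1)) Nat.one_div_pos_of_nat
  obtain ⟨T, hT, φ, hφ, hlim⟩ :=
    (isCompact_quadParams.prod isCompact_quadParams).tendsto_subseq ht
  refine ⟨T, hT, fun i => ?_⟩
  have hε : Tendsto (fun N => 1 / (((φ N : ℕ) : ℝ) + 1)) atTop (nhds 0) :=
    tendsto_one_div_add_atTop_nhds_zero_nat.comp hφ.tendsto_atTop
  have hcont : Continuous fun p : ℝ × ((ℂ × ℂ) × (ℂ × ℂ)) =>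
      ((w i + p.1 * m i) * realQuad p.2.2 (z i) * (starRingEnd ℂ) (realQuad p.2.1 (z i))).im := by
    have h1 : Continuous fun p : ℝ × ((ℂ × ℂ) × (ℂ × ℂ)) => realQuad p.2.2 (z i) :=
      (continuous_realQuad (z i)).comp (by fun_prop)
    have h2 : Continuous fun p : ℝ × ((ℂ × ℂ) × (ℂ × ℂ)) => realQuad p.2.1 (z i) :=
      (continuous_realQuad (z i)).comp (by fun_prop)
    fun_prop
  have h3 := (hcont.tendsto (0, T)).comp (hε.prodMk_nhds hlim)
  have h4 := ge_of_tendsto' h3 fun N => htp (φ N) i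
  simpa using h4

/-- Positivity of the Pick kernel of a disc for functions with nonnegative real part. -/
theorem disc_pick_nonneg {c : ℂ} {R : ℝ} {F : ℂ → ℂ}
    (hF : DifferentiableOn ℂ F (Metric.closedBall c R))
    (hre : ∀ ζ ∈ Metric.closedBall c R, 0 ≤ (F ζ).re) {n : ℕ} {z : Fin n → ℂ}
    (hz : ∀ i, z i ∈ Metric.ball c R) (x : Fin n → ℂ) :
    0 ≤ (∑ i, ∑ j, (starRingEnd ℂ) (x i) * x j *
      (F (z i) / (R ^ 2 - (z i - c) * (starRingEnd ℂ) (z j - c)))).re := by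
  rcases isEmpty_or_nonempty (Fin n) with hn | ⟨⟨i₀⟩⟩
  · simp
  have hR : 0 < R := dist_nonneg.trans_lt (hz i₀)
  have hden : ∀ j, ∀ ζ ∈ Metric.closedBall c R,
      (R : ℂ) ^ 2 - (ζ - c) * (starRingEnd ℂ) (z j - c) ≠ 0 := by
    intro j ζ hζ h
    have h1 : ‖(R : ℂ) ^ 2‖ = ‖(ζ - c) * (starRingEnd ℂ) (z j - c)‖ := by rw [sub_eq_zero.1 h]
    rw [norm_pow, norm_mul, norm_conj, norm_real, Real.norm_eq_abs, sq_abs] at h1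
    have h2 : ‖ζ - c‖ ≤ R := by simpa [dist_eq_norm] using hζ
    have h3 : ‖z j - c‖ < R := by simpa [dist_eq_norm] using hz j
    nlinarith [norm_nonneg (ζ - c), norm_nonneg (z j - c)]
  have hcauchy : ∀ i j, (∮ ζ in C(c, R), (ζ - z i)⁻¹ •
      (F ζ / (R ^ 2 - (ζ - c) * (starRingEnd ℂ) (z j - c)))) =
        (2 * Real.pi * I : ℂ) • (F (z i) / (R ^ 2 - (z i - c) * (starRingEnd ℂ) (z j - c))) := by
    intro i j
    refine DifferentiableOn.circleIntegral_sub_inv_smul ?_ (hz i)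
    exact hF.div (by fun_prop) (hden j)
  have hmem : ∀ θ, circleMap c R θ ∈ Metric.closedBall c R := fun θ =>
    circleMap_mem_closedBall c hR.le θ
  have hne : ∀ i θ, circleMap c R θ - z i ≠ 0 := fun i θ =>
    sub_ne_zero.2 (circleMap_ne_mem_ball (hz i) θ)
  have hFc : Continuous fun θ => F (circleMap c R θ) :=
    hF.continuousOn.comp_continuous (continuous_circleMap c R) hmem
  set G : ℝ → ℂ := fun θ => ∑ i, (starRingEnd ℂ) (x i) / (circleMap c R θ - z i) with hG
  have hGc : Continuous G := by
    refine continuous_finsetSum _ fun i _ => ?_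
    exact continuous_const.div (by fun_prop) (hne i)
  have hintegral : (2 * Real.pi : ℂ) * (∑ i, ∑ j, (starRingEnd ℂ) (x i) * x j *
      (F (z i) / (R ^ 2 - (z i - c) * (starRingEnd ℂ) (z j - c)))) =
      ∫ θ in (0 : ℝ)..2 * Real.pi, F (circleMap c R θ) * ((normSq (G θ) : ℝ) : ℂ) := by
    have hterm : ∀ θ, F (circleMap c R θ) * ((normSq (G θ) : ℝ) : ℂ) =
        ∑ i, ∑ j, (starRingEnd ℂ) (x i) * x j * (-I * (deriv (circleMap c R) θ •
          ((circleMap c R θ - z i)⁻¹ • (F (circleMap c R θ) /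
            (R ^ 2 - (circleMap c R θ - c) * (starRingEnd ℂ) (z j - c)))))) := by
      intro θ
      rw [← mul_conj, hG]
      rw [map_sum, Finset.sum_mul_sum]
      simp only [Finset.mul_sum]
      refine Finset.sum_congr rfl fun i _ => Finset.sum_congr rfl fun j _ => ?_
      have h1 := hne i θ
      have h2 := (map_ne_zero (starRingEnd ℂ)).2 (hne j θ)
      have h3 := hden j _ (hmem θ)
      have h4 : (circleMap c R θ - c) * (starRingEnd ℂ) (circleMap c R θ - c) = (R : ℂ) ^ 2 := by
        rw [mul_conj, normSq_eq_norm_sq, circleMap_sub_center]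
        simp [sq_abs]
      have h5 : (R : ℂ) ^ 2 - (circleMap c R θ - c) * (starRingEnd ℂ) (z j - c) =
          circleMap 0 R θ * (starRingEnd ℂ) (circleMap c R θ - z j) := by
        rw [← h4, circleMap_sub_center, ← circleMap_sub_center c]
        simp only [map_sub]
        ring
      have h6 : circleMap 0 R θ ≠ 0 := circleMap_ne_center hR.ne'
      rw [deriv_circleMap, h5]
      simp only [smul_eq_mul, map_div₀, conj_conj]
      field_simp
      rw [I_sq]
      ring
    have hcont : ∀ i j, Continuous fun θ => deriv (circleMap c R) θ •
          ((circleMap c R θ - z i)⁻¹ • (F (circleMap c R θ) /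
            (R ^ 2 - (circleMap c R θ - c) * (starRingEnd ℂ) (z j - c)))) := by
      intro i j
      simp only [deriv_circleMap, smul_eq_mul]
      refine Continuous.mul ?_ (Continuous.mul ?_ ?_)
      · fun_prop
      · exact Continuous.inv₀ (by fun_prop) (hne i)
      · exact hFc.div (by fun_prop) fun θ => hden j _ (hmem θ)
    simp only [hterm]
    have hcont' : ∀ i j, Continuous fun θ => (starRingEnd ℂ) (x i) * x j * (-I *
        (deriv (circleMap c R) θ • ((circleMap c R θ - z i)⁻¹ • (F (circleMap c R θ) /
          (R ^ 2 - (circleMap c R θ - c) * (starRingEnd ℂ) (z j - c)))))) := fun i j =>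
      continuous_const.mul (continuous_const.mul (hcont i j))
    rw [intervalIntegral.integral_finsetSum, Finset.mul_sum]
    swap
    · exact fun i _ => (continuous_finsetSum _ fun j _ => hcont' i j).intervalIntegrable _ _
    refine Finset.sum_congr rfl fun i _ => ?_
    rw [intervalIntegral.integral_finsetSum, Finset.mul_sum]
    swap
    · exact fun j _ => (hcont' i j).intervalIntegrable _ _
    refine Finset.sum_congr rfl fun j _ => ?_
    rw [intervalIntegral.integral_const_mul, intervalIntegral.integral_const_mul]
    have h7 := hcauchy i j
    rw [circleIntegral] at h7
    rw [h7, smul_eq_mul]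
    linear_combination (2 * Real.pi * (starRingEnd ℂ) (x i) * x j *
      (F (z i) / (R ^ 2 - (z i - c) * (starRingEnd ℂ) (z j - c)))) * I_sq
  have hpos : 0 ≤ (∫ θ in (0 : ℝ)..2 * Real.pi,
      F (circleMap c R θ) * ((normSq (G θ) : ℝ) : ℂ)).re := by
    have hi : IntervalIntegrable (fun θ => F (circleMap c R θ) * ((normSq (G θ) : ℝ) : ℂ))
        volume 0 (2 * Real.pi) := by
      refine Continuous.intervalIntegrable (hFc.mul ?_) _ _
      exact continuous_ofReal.comp (continuous_normSq.comp hGc)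
    have h8 := reCLM.intervalIntegral_comp_comm hi
    rw [reCLM_apply] at h8
    rw [← h8]
    refine intervalIntegral.integral_nonneg (by positivity) fun θ _ => ?_
    rw [reCLM_apply, re_mul_ofReal]
    exact mul_nonneg (hre _ (hmem θ)) (normSq_nonneg _)
  rw [← hintegral, show (2 * Real.pi : ℂ) = ((2 * Real.pi : ℝ) : ℂ) by push_cast; rfl,
    re_ofReal_mul] at hpos
  exact nonneg_of_mul_nonneg_right hpos (by positivity)

/-- The Pick form of a function with nonnegative imaginary part on the upper half-plane is
nonnegative. -/
theorem pickForm_nonneg {M : ℂ → ℂ} (hM : DifferentiableOn ℂ M {z | 0 < z.im})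
    (him : ∀ z, 0 < z.im → 0 ≤ (M z).im) {n : ℕ} {z : Fin n → ℂ} (hz : ∀ i, 0 < (z i).im)
    (x : Fin n → ℂ) : 0 ≤ (pickForm z (fun i => M (z i)) x x).re := by
  set T : ℂ := ∑ i, ∑ j, (starRingEnd ℂ) (x i) * x j *
    (M (z i) / (z i - (starRingEnd ℂ) (z j))) with hT
  have hform : pickForm z (fun i => M (z i)) x x = T + (starRingEnd ℂ) T := by
    have hTc : (starRingEnd ℂ) T = ∑ i, ∑ j, (starRingEnd ℂ) (x i) * x j *
        (-(starRingEnd ℂ) (M (z j)) / (z i - (starRingEnd ℂ) (z j))) := by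
      rw [hT, Finset.sum_comm]
      simp only [map_sum, map_mul, map_div₀, map_sub, conj_conj]
      refine Finset.sum_congr rfl fun i _ => Finset.sum_congr rfl fun j _ => ?_
      rw [← neg_sub (z i), div_neg, neg_div]
      ring
    rw [pickForm_apply, hTc, hT, ← Finset.sum_add_distrib]
    refine Finset.sum_congr rfl fun i _ => ?_
    rw [← Finset.sum_add_distrib]
    refine Finset.sum_congr rfl fun j _ => ?_
    ring
  suffices h : 0 ≤ T.re by
    rw [hform, add_re, conj_re]
    linarith
  set S : ℕ → ℂ := fun N => ∑ i, ∑ j, (starRingEnd ℂ) (x i) * x j *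
      ((-I * M (z i)) / (((N - 1 / N : ℝ) : ℂ) ^ 2 -
        (z i - N * I) * (starRingEnd ℂ) (z j - N * I))) with hS
  have hlim : Tendsto (fun N : ℕ => ((N : ℝ) : ℂ) * S N) atTop (nhds T) := by
    simp only [hS, Finset.mul_sum]
    refine tendsto_finsetSum _ fun i _ => tendsto_finsetSum _ fun j _ => ?_
    have hzz := sub_conj_ne_zero (hz i) (hz j)
    have hinv : Tendsto (fun N : ℕ => (N : ℂ)⁻¹) atTop (nhds 0) :=
      tendsto_inv_atTop_nhds_zero_nat
    have h1 : Tendsto (fun N : ℕ => (starRingEnd ℂ) (x i) * x j * ((-I * M (z i)) /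
        ((-2 + (N : ℂ)⁻¹ ^ 2 - z i * (starRingEnd ℂ) (z j)) * (N : ℂ)⁻¹ -
          I * (z i - (starRingEnd ℂ) (z j))))) atTop
        (nhds ((starRingEnd ℂ) (x i) * x j * ((-I * M (z i)) /
        ((-2 + (0 : ℂ) ^ 2 - z i * (starRingEnd ℂ) (z j)) * 0 -
          I * (z i - (starRingEnd ℂ) (z j)))))) := by
      refine tendsto_const_nhds.mul (tendsto_const_nhds.div ?_ (by simp [hzz]))
      exact ((((hinv.pow 2).const_add _).sub_const _).mul hinv).sub_const _
    have h2 : (-I * M (z i)) / ((-2 + (0 : ℂ) ^ 2 - z i * (starRingEnd ℂ) (z j)) * 0 -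
          I * (z i - (starRingEnd ℂ) (z j))) = M (z i) / (z i - (starRingEnd ℂ) (z j)) := by
      rw [mul_zero, zero_sub, ← neg_mul, mul_div_mul_left _ _ (neg_ne_zero.2 I_ne_zero)]
    rw [h2] at h1
    refine h1.congr' ?_
    filter_upwards [eventually_ge_atTop 1] with N hN
    have hN0 : (N : ℂ) ≠ 0 := by exact_mod_cast Nat.one_le_iff_ne_zero.1 hN
    have h3 : ((N - 1 / N : ℝ) : ℂ) ^ 2 - (z i - N * I) * (starRingEnd ℂ) (z j - N * I) =
        N * ((-2 + (N : ℂ)⁻¹ ^ 2 - z i * (starRingEnd ℂ) (z j)) * (N : ℂ)⁻¹ -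
          I * (z i - (starRingEnd ℂ) (z j))) := by
      simp only [map_sub, map_mul, conj_I, map_natCast]
      push_cast
      field_simp
      ring_nf
      rw [I_sq]
      ring
    rw [h3, ofReal_natCast]
    field_simp
  refine ge_of_tendsto ((continuous_re.tendsto T).comp hlim) ?_
  have hev : ∀ᶠ N : ℕ in atTop, ∀ i, normSq (z i) + 2 < 2 * N * (z i).im := by
    refine eventually_all.2 fun i => ?_
    have : Tendsto (fun N : ℕ => 2 * (N : ℝ) * (z i).im) atTop atTop :=
      (tendsto_natCast_atTop_atTop.const_mul_atTop two_pos).atTop_mul_const (hz i)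
    exact this.eventually_gt_atTop _
  filter_upwards [hev, eventually_ge_atTop 2] with N hN hN2
  have hNpos : (2 : ℝ) ≤ N := by exact_mod_cast hN2
  have hNinv : 0 < 1 / (N : ℝ) := by positivity
  have hNinv' : 1 / (N : ℝ) ≤ 1 := by rw [div_le_one (by linarith)]; linarith
  have hball : ∀ ζ ∈ Metric.closedBall (N * I) (N - 1 / N : ℝ), 0 < ζ.im := by
    intro ζ hζ
    rw [mem_closedBall_iff_norm] at hζ
    have h4 := (abs_im_le_norm _).trans hζ
    have h5 := (abs_le.1 h4).1
    simp at h5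
    rw [one_div] at hNinv
    linarith
  have h6 := disc_pick_nonneg (c := N * I) (R := N - 1 / N) (F := fun ζ => -I * M ζ)
    ((hM.mono hball).const_mul _) (fun ζ hζ => by simpa using him ζ (hball ζ hζ)) (z := z)
    (fun i => by
      rw [mem_ball_iff_norm]
      refine lt_of_pow_lt_pow_left₀ 2 (by linarith) ?_
      rw [← normSq_eq_norm_sq]
      have h7 := hN i
      rw [normSq_apply] at h7 ⊢
      simp only [sub_re, sub_im, mul_re, mul_im, natCast_re, natCast_im, I_re, I_im]
      have h8 : (N : ℝ) * (1 / N) = 1 := by field_simp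
      nlinarith [sq_nonneg (1 / (N : ℝ))]) x
  change 0 ≤ (((N : ℝ) : ℂ) * S N).re
  rw [re_ofReal_mul]
  exact mul_nonneg (by linarith) h6

open scoped Topology

/-- An isolated singularity of a holomorphic function with nonnegative imaginary part is
removable. -/
theorem exists_analyticAt_of_im_nonneg {g : ℂ → ℂ} {e : ℂ}
    (h : ∀ᶠ z in 𝓝[≠] e, DifferentiableAt ℂ g z ∧ 0 ≤ (g z).im) :
    ∃ G : ℂ → ℂ, AnalyticAt ℂ G e ∧ ∀ᶠ z in 𝓝[≠] e, G z = g z := by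
  have hne : ∀ w : ℂ, 0 ≤ w.im → w + I ≠ 0 := fun w hw h0 => by
    have := congrArg im h0
    simp at this
    linarith
  set c : ℂ → ℂ := fun z => (g z - I) / (g z + I) with hc
  set s : Set ℂ := {z | z ≠ e → DifferentiableAt ℂ g z ∧ 0 ≤ (g z).im} with hs
  have hse : s ∈ 𝓝 e := eventually_nhdsWithin_iff.1 h
  have hsz : ∀ z ∈ s \ {e}, DifferentiableAt ℂ g z ∧ 0 ≤ (g z).im := fun z hz => hz.1 hz.2
  have hcd : DifferentiableOn ℂ c (s \ {e}) := fun z hz =>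
    (((hsz z hz).1.sub_const I).div ((hsz z hz).1.add_const I)
      (hne _ (hsz z hz).2)).differentiableWithinAt
  have hcn : ∀ z ∈ s \ {e}, ‖c z‖ ≤ 1 := by
    intro z hz
    have h1 := (hsz z hz).2
    rw [hc, norm_div, div_le_one (norm_pos_iff.2 (hne _ h1))]
    refine le_of_sq_le_sq ?_ (norm_nonneg _)
    rw [← normSq_eq_norm_sq, ← normSq_eq_norm_sq, normSq_apply, normSq_apply]
    simp only [sub_re, sub_im, add_re, add_im, I_re, I_im]
    nlinarith
  set u := Function.update c e (limUnder (𝓝[≠] e) c) with hu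
  have hud : DifferentiableOn ℂ u s := differentiableOn_update_limUnder_of_bddAbove hse hcd
    ⟨1, by rintro _ ⟨z, hz, rfl⟩; exact hcn z hz⟩
  have huc : ∀ z, z ≠ e → u z = c z := fun z hz => Function.update_of_ne hz _ _
  have hua : AnalyticAt ℂ u e := hud.analyticAt hse
  have hu1 : u e ≠ 1 := by
    intro h1
    have hmax : IsLocalMax (norm ∘ u) e := by
      filter_upwards [hse] with z hz
      simp only [Function.comp_apply, h1, norm_one]
      rcases eq_or_ne z e with rfl | hze
      · simp [h1]
      · rw [huc z hze]
        exact hcn z ⟨hz, hze⟩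
    have h2 := eventually_eq_of_isLocalMax_norm
      (hua.eventually_analyticAt.mono fun z hz => hz.differentiableAt) hmax
    have h3 : ∀ᶠ z in 𝓝[≠] e, False := by
      filter_upwards [h2.filter_mono nhdsWithin_le_nhds, h, self_mem_nhdsWithin] with z hz hgz hze
      rw [huc z hze, h1, hc, div_eq_one_iff_eq (hne _ hgz.2)] at hz
      have := congrArg im hz
      simp at this
      linarith
    exact h3.exists.choose_spec
  refine ⟨fun z => I * (1 + u z) / (1 - u z), ?_, ?_⟩
  · exact (analyticAt_const.mul (analyticAt_const.add hua)).div (analyticAt_const.sub hua)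
      (sub_ne_zero.2 hu1.symm)
  · filter_upwards [h, self_mem_nhdsWithin] with z hgz hze
    have h1 := hne _ hgz.2
    rw [huc z hze, hc]
    have h2 : 1 + (g z - I) / (g z + I) = 2 * g z / (g z + I) := by field_simp; ring
    have h3 : 1 - (g z - I) / (g z + I) = 2 * I / (g z + I) := by field_simp; ring
    have h4 := I_ne_zero
    rw [h2, h3]
    field_simp

/-- A holomorphic function with nonnegative imaginary part on the upper half-plane minus a
discrete set extends to the upper half-plane. -/
theorem exists_extension_of_im_nonneg {g : ℂ → ℂ}
    (h : ∀ e : ℂ, 0 < e.im → ∀ᶠ z in 𝓝[≠] e, DifferentiableAt ℂ g z ∧ 0 ≤ (g z).im) :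
    ∃ M : ℂ → ℂ, (∀ e : ℂ, 0 < e.im → DifferentiableAt ℂ M e) ∧
      (∀ e : ℂ, 0 < e.im → 0 ≤ (M e).im) ∧
      ∀ e : ℂ, 0 < e.im → ∀ᶠ z in 𝓝[≠] e, M z = g z := by
  set M : ℂ → ℂ := fun z => limUnder (𝓝[≠] z) g with hM
  have key : ∀ e : ℂ, 0 < e.im → ∃ G : ℂ → ℂ, AnalyticAt ℂ G e ∧
      (∀ᶠ z in 𝓝[≠] e, G z = g z) ∧ ∀ᶠ z in 𝓝 e, M z = G z := by
    intro e he
    obtain ⟨G, hG, hGg⟩ := exists_analyticAt_of_im_nonneg (h e he)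
    have hlim : ∀ z, ContinuousAt G z → (∀ᶠ w in 𝓝[≠] z, G w = g w) → M z = G z :=
      fun z hz hzg => ((hz.tendsto.mono_left nhdsWithin_le_nhds).congr' hzg).limUnder_eq
    refine ⟨G, hG, hGg, ?_⟩
    have h1 := eventually_nhdsWithin_iff.1 (eventually_eventually_nhdsWithin.2 hGg)
    filter_upwards [hG.eventually_continuousAt, h1] with z hz hzg
    rcases eq_or_ne z e with rfl | hze
    · exact hlim z hz hGg
    · refine hlim z hz ?_
      have h2 := hzg hze
      rw [isOpen_compl_singleton.nhdsWithin_eq hze] at h2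
      exact h2.filter_mono nhdsWithin_le_nhds
  refine ⟨M, fun e he => ?_, fun e he => ?_, fun e he => ?_⟩ <;>
    obtain ⟨G, hG, hGg, hMG⟩ := key e he
  · exact hG.differentiableAt.congr_of_eventuallyEq hMG
  · rw [hMG.self_of_nhds]
    have h1 : Tendsto (fun z => (G z).im) (𝓝[≠] e) (𝓝 (G e).im) :=
      ((continuous_im.tendsto _).comp hG.continuousAt.tendsto).mono_left nhdsWithin_le_nhds
    refine ge_of_tendsto h1 ?_
    filter_upwards [hGg, h e he] with z hz hgz
    rw [hz]
    exact hgz.2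
  · filter_upwards [hGg, hMG.filter_mono nhdsWithin_le_nhds] with z hz hz'
    rw [hz', hz]

theorem IsGenNevanlinnaOne.eventually_mem {Q : ℂ → ℂ} {D : Set ℂ} (hQ : IsGenNevanlinnaOne Q D)
    {e : ℂ} (he : e.im ≠ 0) : ∀ᶠ z in 𝓝[≠] e, z ∈ D := by
  by_cases h : e ∈ D
  · exact (hQ.isOpen.eventually_mem h).filter_mono nhdsWithin_le_nhds
  · have h1 := inf_principal_eq_bot.1 (discreteTopology_subtype_iff.1 hQ.discrete_compl e ⟨he, h⟩)
    have h2 : ∀ᶠ z : ℂ in 𝓝 e, z.im ≠ 0 := continuous_im.continuousAt.eventually_ne he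
    filter_upwards [h1, h2.filter_mono nhdsWithin_le_nhds] with z hz hz'
    by_contra hzD
    exact hz ⟨hz', hzD⟩

theorem IsGenNevanlinnaOne.differentiableAt {Q : ℂ → ℂ} {D : Set ℂ} (hQ : IsGenNevanlinnaOne Q D)
    {z : ℂ} (hz : z ∈ D) : DifferentiableAt ℂ Q z :=
  hQ.holo.differentiableAt (hQ.isOpen.mem_nhds hz)

/-- Two functions continuous at a point coincide there if they do so on a punctured
neighbourhood. -/
theorem eq_of_eventually_nhdsNE {f g : ℂ → ℂ} {e : ℂ} (hf : ContinuousAt f e)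
    (hg : ContinuousAt g e) (h : ∀ᶠ z in 𝓝[≠] e, f z = g z) : f e = g e :=
  ((hf.eventuallyEq_nhds_iff_eventuallyEq_nhdsNE hg).1 h).eq_of_nhds

/-- The generic factorization: if `Q * S / P` has nonnegative imaginary part on the upper
half-plane, then it is a Nevanlinna function. -/
theorem IsGenNevanlinnaOne.exists_mul_eq_mul {Q : ℂ → ℂ} {D : Set ℂ}
    (hQ : IsGenNevanlinnaOne Q D) {P S : ℂ → ℂ} (hP : Differentiable ℂ P)
    (hS : Differentiable ℂ S) (hPc : ∀ z, P ((starRingEnd ℂ) z) = (starRingEnd ℂ) (P z))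
    (hSc : ∀ z, S ((starRingEnd ℂ) z) = (starRingEnd ℂ) (S z))
    (hP0 : ∀ e, ∀ᶠ z in 𝓝[≠] e, P z ≠ 0)
    (him : ∀ z ∈ D, 0 < z.im → 0 ≤ (Q z * S z * (starRingEnd ℂ) (P z)).im) :
    ∃ M, IsNevanlinna M ∧ ∀ z ∈ D, Q z * S z = P z * M z := by
  have hpos : ∀ e : ℂ, 0 < e.im → ∀ᶠ z : ℂ in 𝓝[≠] e, 0 < z.im := fun e he =>
    (continuous_im.continuousAt.eventually_const_lt he).filter_mono nhdsWithin_le_nhds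
  obtain ⟨M, hMd, hMim, hMg⟩ := exists_extension_of_im_nonneg (g := fun z => Q z * S z / P z) (by
    intro e he
    filter_upwards [hQ.eventually_mem he.ne', hpos e he, hP0 e] with z hzD hz hPz
    refine ⟨((hQ.differentiableAt hzD).mul (hS z)).div (hP z) hPz, ?_⟩
    have h1 : Q z * S z / P z = ((normSq (P z))⁻¹ : ℝ) * (Q z * S z * (starRingEnd ℂ) (P z)) := by
      rw [div_eq_mul_inv, inv_def]
      push_cast
      ring
    rw [h1, im_ofReal_mul]
    exact mul_nonneg (inv_nonneg.2 (normSq_nonneg _)) (him z hzD hz))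
  have hup : ∀ z ∈ D, 0 < z.im → Q z * S z = P z * M z := by
    intro e heD he
    refine eq_of_eventually_nhdsNE (f := fun z => Q z * S z) (g := fun z => P z * M z)
      ((hQ.differentiableAt heD).mul (hS e)).continuousAt
      ((hP e).mul (hMd e he)).continuousAt ?_
    filter_upwards [hMg e he, hP0 e] with z hz hPz
    rw [hz]
    field_simp
  set N : ℂ → ℂ := fun z => if 0 < z.im then M z else (starRingEnd ℂ) (M ((starRingEnd ℂ) z))
    with hN
  have hNpos : ∀ z : ℂ, 0 < z.im → N z = M z := fun z hz => if_pos hz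
  have hNneg : ∀ z : ℂ, z.im < 0 → N z = (starRingEnd ℂ) (M ((starRingEnd ℂ) z)) :=
    fun z hz => if_neg hz.not_gt
  have hconj : ∀ z : ℂ, z.im < 0 → 0 < ((starRingEnd ℂ) z).im := fun z hz => by
    rw [conj_im]
    linarith
  refine ⟨N, ⟨fun z hz => DifferentiableAt.differentiableWithinAt ?_, fun z hz => ?_,
    fun z hz => ?_⟩, fun z hz => ?_⟩
  · rcases lt_or_gt_of_ne hz with hz | hz
    · have h1 : DifferentiableAt ℂ (starRingEnd ℂ ∘ M ∘ starRingEnd ℂ) z :=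
        differentiableAt_conj_conj_iff.2 (hMd _ (hconj z hz))
      refine h1.congr_of_eventuallyEq ?_
      filter_upwards [continuous_im.continuousAt.eventually_lt_const hz] with w hw
      exact hNneg w hw
    · refine (hMd z hz).congr_of_eventuallyEq ?_
      filter_upwards [continuous_im.continuousAt.eventually_const_lt hz] with w hw
      exact hNpos w hw
  · rcases lt_or_gt_of_ne hz with hz | hz
    · rw [hNneg z hz, hNpos _ (hconj z hz), conj_conj]
    · rw [hNpos z hz, hNneg _ (by rw [conj_im]; linarith), conj_conj]
  · rw [hNpos z hz]
    exact hMim z hz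
  · rcases lt_or_gt_of_ne (hQ.subset hz) with h | h
    · have h1 := congrArg (starRingEnd ℂ) (hup _ (hQ.conj_mem z hz) (hconj z h))
      rw [hQ.symm z hz, hPc, hSc, map_mul, map_mul, conj_conj, conj_conj, conj_conj] at h1
      rw [h1, hNneg z h]
    · rw [hNpos z h]
      exact hup z hz h

theorem IsNevanlinna.eq_zero {M : ℂ → ℂ} (hM : IsNevanlinna M) {β : ℂ} (hβ : β.im ≠ 0)
    (h0 : M β = 0) {z : ℂ} (hz : z.im ≠ 0) : M z = 0 := by
  have hconv : IsPreconnected {z : ℂ | 0 < z.im} := (convex_halfSpace_im_gt 0).isPreconnected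
  have hopen : IsOpen {z : ℂ | 0 < z.im} := isOpen_lt continuous_const continuous_im
  have hup : ∀ β : ℂ, 0 < β.im → M β = 0 → ∀ z : ℂ, 0 < z.im → M z = 0 := by
    intro β hβ h0 z hz
    have han : AnalyticOnNhd ℂ M {z : ℂ | 0 < z.im} :=
      (hM.holo.mono fun w (hw : 0 < w.im) => hw.ne').analyticOnNhd hopen
    rcases han.is_constant_or_isOpen hconv with ⟨w, hw⟩ | h
    · rw [hw z hz, ← hw β hβ, h0]
    · have h1 := (h _ subset_rfl hopen).mem_nhds ⟨β, hβ, h0⟩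
      obtain ⟨ε, hε, hball⟩ := Metric.mem_nhds_iff.1 h1
      obtain ⟨w, hw, hMw⟩ := hball (show (-((ε / 2 : ℝ) : ℂ) * I) ∈ Metric.ball 0 ε by
        rw [mem_ball_zero_iff, norm_mul, norm_neg, norm_real, norm_I, mul_one, Real.norm_eq_abs,
          abs_of_pos (half_pos hε)]
        linarith)
      have h2 := hM.im_nonneg w hw
      rw [hMw] at h2
      simp at h2
      linarith
  have hcpos : ∀ z : ℂ, z.im < 0 → 0 < ((starRingEnd ℂ) z).im := fun z hz => by
    rw [conj_im]
    linarith
  have hall : ∀ z : ℂ, 0 < z.im → M z = 0 := by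
    rcases lt_or_gt_of_ne hβ with h | h
    · exact hup _ (hcpos β h) (by rw [hM.symm β hβ, h0, map_zero])
    · exact hup β h h0
  rcases lt_or_gt_of_ne hz with h | h
  · have h1 := hM.symm z hz
    rw [hall _ (hcpos z h)] at h1
    exact (map_eq_zero _).1 h1.symm
  · exact hall z h

/-- Cancelling a function with isolated zeros from an identity on `D`. -/
theorem IsGenNevanlinnaOne.eq_div_mul {Q M P S : ℂ → ℂ} {D : Set ℂ}
    (hQ : IsGenNevanlinnaOne Q D) (hM : IsNevanlinna M)
    (hS0 : ∀ e, ∀ᶠ z in 𝓝[≠] e, S z ≠ 0) (hSP : ∀ z : ℂ, z.im ≠ 0 → S z = 0 → P z ≠ 0)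
    (h : ∀ z ∈ D, Q z * S z = P z * M z) : ∀ z ∈ D, Q z = P z / S z * M z := by
  intro z hz
  have hzim := hQ.subset hz
  by_cases hSz : S z = 0
  · have h1 := h z hz
    rw [hSz, mul_zero, eq_comm, mul_eq_zero] at h1
    have h2 := h1.resolve_left (hSP z hzim hSz)
    rw [h2, mul_zero]
    refine eq_of_eventually_nhdsNE (f := Q) (g := fun _ => 0)
      (hQ.differentiableAt hz).continuousAt continuousAt_const ?_
    filter_upwards [hQ.eventually_mem hzim, hS0 z] with w hw hSw
    have h3 := h w hw
    rw [hM.eq_zero hzim h2 (hQ.subset hw), mul_zero] at h3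
    exact (mul_eq_zero.1 h3).resolve_right hSw
  · rw [div_mul_eq_mul_div, ← h z hz]
    field_simp

/-- A generalized Nevanlinna function with one negative square is not a Nevanlinna function. -/
theorem IsGenNevanlinnaOne.not_forall_eq {Q M P : ℂ → ℂ} {D : Set ℂ}
    (hQ : IsGenNevanlinnaOne Q D) (hM : IsNevanlinna M)
    (hP0 : ∀ e, ∀ᶠ z in 𝓝[≠] e, P z ≠ 0) (h : ∀ z ∈ D, Q z * P z = P z * M z) : False := by
  have hQM : ∀ z ∈ D, Q z = M z := by
    intro z hz
    refine eq_of_eventually_nhdsNE (hQ.differentiableAt hz).continuousAt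
      (hM.holo.differentiableAt ((isOpen_ne_fun continuous_im continuous_const).mem_nhds
        (hQ.subset hz))).continuousAt ?_
    filter_upwards [hQ.eventually_mem (hQ.subset hz), hP0 z] with w hw hPw
    have h1 := h w hw
    rw [mul_comm] at h1
    exact mul_left_cancel₀ hPw h1
  obtain ⟨n, z, hz, h1⟩ := hQ.exists_one
  have h2 : nevKernel Q z = pickMatrix z (fun i => M (z i)) := by
    ext i j
    simp only [nevKernel, pickMatrix, Matrix.of_apply, hQM _ (hz _).1]
  rw [h2, negEigCount_eq_zero] at h1
  · exact zero_ne_one h1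
  · intro x
    rw [← pickForm_eq_dotProduct]
    exact pickForm_nonneg (hM.holo.mono fun w (hw : 0 < w.im) => hw.ne') hM.im_nonneg
      (fun i => (hz i).2) x

theorem IsGenNevanlinnaOne.exists_quadParams {Q : ℂ → ℂ} {D : Set ℂ}
    (hQ : IsGenNevanlinnaOne Q D) : ∃ t ∈ quadParams ×ˢ quadParams, ∀ z ∈ D, 0 < z.im →
      0 ≤ (Q z * realQuad t.2 z * (starRingEnd ℂ) (realQuad t.1 z)).im := by
  obtain ⟨t, ht, ht'⟩ := (isCompact_quadParams.prod isCompact_quadParams).inter_iInter_nonempty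
    (fun z : {z : ℂ // z ∈ D ∧ 0 < z.im} =>
      {t | 0 ≤ (Q z * realQuad t.2 z * (starRingEnd ℂ) (realQuad t.1 z)).im})
    (fun z => by
      have h1 := (continuous_realQuad z).comp (continuous_fst (X := ℂ × ℂ) (Y := ℂ × ℂ))
      have h2 := (continuous_realQuad z).comp (continuous_snd (X := ℂ × ℂ) (Y := ℂ × ℂ))
      exact isClosed_le continuous_const (continuous_im.comp
        ((continuous_const.mul h2).mul (continuous_conj.comp h1))))
    (fun s => by
      set z : Fin s.card → ℂ := fun i => (s.equivFin.symm i : {z : ℂ // z ∈ D ∧ 0 < z.im}) with hz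
      have hinj : Function.Injective z :=
        Subtype.val_injective.comp (Subtype.val_injective.comp s.equivFin.symm.injective)
      have hzD : ∀ i, z i ∈ D ∧ 0 < (z i).im := fun i => (s.equivFin.symm i).1.2
      obtain ⟨l, hl⟩ := exists_linear_of_negEigCount_le_one
        (pickMatrix_isHermitian z fun i => Q (z i)) (hQ.le_one _ z hzD)
      obtain ⟨t, ht, h1⟩ := exists_quadParams_of_pickForm (fun i => (hzD i).2) hinj l
        (fun x hx => (hl x hx).trans_eq (congrArg re (pickForm_eq_dotProduct _ _ _).symm))
      refine ⟨t, ht, mem_iInter₂.2 fun w hw => ?_⟩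
      simpa [hz] using h1 (s.equivFin ⟨w, hw⟩))
  exact ⟨t, ht, fun z hzD hz => mem_iInter.1 ht' ⟨z, hzD, hz⟩⟩

/-- The monic real quadratic polynomial with zeros `α` and `conj α`. -/
noncomputable def conjQuad (α z : ℂ) : ℂ := (z - α) * (z - (starRingEnd ℂ) α)

theorem differentiable_conjQuad (α : ℂ) : Differentiable ℂ (conjQuad α) := by
  unfold conjQuad
  fun_prop

theorem conjQuad_conj (α z : ℂ) :
    conjQuad α ((starRingEnd ℂ) z) = (starRingEnd ℂ) (conjQuad α z) := by
  simp only [conjQuad, map_mul, map_sub, conj_conj]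
  ring

theorem conjQuad_eq_zero {α z : ℂ} : conjQuad α z = 0 ↔ z = α ∨ z = (starRingEnd ℂ) α := by
  rw [conjQuad, mul_eq_zero, sub_eq_zero, sub_eq_zero]

theorem eventually_conjQuad_ne_zero (α e : ℂ) : ∀ᶠ z in 𝓝[≠] e, conjQuad α z ≠ 0 := by
  have h : ∀ a : ℂ, ∀ᶠ z in 𝓝[≠] e, z ≠ a := fun a => by
    rcases eq_or_ne e a with rfl | hea
    · exact self_mem_nhdsWithin
    · exact (continuousAt_id.eventually_ne hea).filter_mono nhdsWithin_le_nhds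
  filter_upwards [h α, h ((starRingEnd ℂ) α)] with z h1 h2 h3
  exact (conjQuad_eq_zero.1 h3).elim h1 h2

theorem conjQuad_ne_zero {α β z : ℂ} (hα : 0 ≤ α.im) (hβ : 0 ≤ β.im) (hαβ : α ≠ β)
    (hz : conjQuad β z = 0) : conjQuad α z ≠ 0 := by
  have key : ∀ a b : ℂ, 0 ≤ a.im → 0 ≤ b.im → b = (starRingEnd ℂ) a → a = b := by
    intro a b ha hb h
    have h1 := congrArg im h
    have h2 := congrArg re h
    rw [conj_im] at h1
    rw [conj_re] at h2
    exact Complex.ext h2.symm (by linarith)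
  intro h
  rcases conjQuad_eq_zero.1 hz with rfl | rfl <;> rcases conjQuad_eq_zero.1 h with h | h
  · exact hαβ h.symm
  · exact hαβ (key _ _ hα hβ h)
  · exact hαβ (key _ _ hβ hα h.symm).symm
  · exact hαβ ((starRingEnd ℂ).injective h).symm

theorem realQuad_eq {t : ℂ × ℂ} (ht : t ∈ quadParams) :
    ∃ c : ℝ, 0 < c ∧ ((∀ z, realQuad t z = c) ∨
      ∃ α : ℂ, 0 ≤ α.im ∧ ∀ z, realQuad t z = c * conjQuad α z) := by
  obtain ⟨a, b⟩ := t
  rcases eq_or_ne a 0 with rfl | ha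
  · have hb : normSq b = 1 := by simpa [quadParams] using ht
    refine ⟨1, one_pos, Or.inl fun z => ?_⟩
    have h1 := mul_conj b
    rw [hb] at h1
    simpa [realQuad] using h1
  · have hac := (map_ne_zero (starRingEnd ℂ)).2 ha
    have hq : ∀ z, realQuad (a, b) z = (normSq a : ℝ) * conjQuad (b / a) z := by
      intro z
      simp only [realQuad, conjQuad, ← mul_conj, map_div₀]
      field_simp
    refine ⟨normSq a, normSq_pos.2 ha, Or.inr ?_⟩
    rcases le_total 0 (b / a).im with h | h
    · exact ⟨b / a, h, hq⟩
    · refine ⟨(starRingEnd ℂ) (b / a), by rw [conj_im]; linarith, fun z => ?_⟩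
      rw [hq, conjQuad, conjQuad, conj_conj, mul_comm (z - b / a)]

/-- Every generalized Nevanlinna function with one negative square
admits a factorization `Q = R·M` with `M` a Nevanlinna function and `R` a rational
function of one of the three indicated forms, where `α, β ∈ ℂ⁺ ∪ ℝ`, `α ≠ β`. -/
theorem statement1 (Q : ℂ → ℂ) (D : Set ℂ) (hQ : IsGenNevanlinnaOne Q D) :
    ∃ M : ℂ → ℂ, IsNevanlinna M ∧
      ((∃ α β : ℂ, 0 ≤ α.im ∧ 0 ≤ β.im ∧ α ≠ β ∧
          ∀ z ∈ D, Q z =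
            ((z - α) * (z - (starRingEnd ℂ) α)) / ((z - β) * (z - (starRingEnd ℂ) β)) * M z) ∨
       (∃ β : ℂ, 0 ≤ β.im ∧
          ∀ z ∈ D, Q z = 1 / ((z - β) * (z - (starRingEnd ℂ) β)) * M z) ∨
       (∃ α : ℂ, 0 ≤ α.im ∧
          ∀ z ∈ D, Q z = (z - α) * (z - (starRingEnd ℂ) α) * M z)) := by
  obtain ⟨t, ht, him⟩ := hQ.exists_quadParams
  obtain ⟨c, hc, hp⟩ := realQuad_eq ht.1
  obtain ⟨d, hd, hq⟩ := realQuad_eq ht.2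
  have hscale : ∀ P S : ℂ → ℂ, (∀ z, realQuad t.1 z = c * P z) → (∀ z, realQuad t.2 z = d * S z) →
      ∀ z ∈ D, 0 < z.im → 0 ≤ (Q z * S z * (starRingEnd ℂ) (P z)).im := by
    intro P S hP hS z hz hz'
    have h1 := him z hz hz'
    rw [hP, hS, map_mul, conj_ofReal, show Q z * (d * S z) * (c * (starRingEnd ℂ) (P z)) =
      ((d * c : ℝ) : ℂ) * (Q z * S z * (starRingEnd ℂ) (P z)) by push_cast; ring,
      im_ofReal_mul] at h1
    exact nonneg_of_mul_nonneg_right h1 (mul_pos hd hc)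
  have hone : ∀ e : ℂ, ∀ᶠ z in 𝓝[≠] e, (1 : ℂ) ≠ 0 := fun e => .of_forall fun _ => one_ne_zero
  rcases hp with hp | ⟨α, hα, hp⟩ <;> rcases hq with hq | ⟨β, hβ, hq⟩
  · obtain ⟨M, hM, h⟩ := hQ.exists_mul_eq_mul (P := fun _ => 1) (S := fun _ => 1)
      (differentiable_const _) (differentiable_const _) (fun _ => (map_one _).symm)
      (fun _ => (map_one _).symm) hone (hscale _ _ (by simpa using hp) (by simpa using hq))
    exact (hQ.not_forall_eq hM hone h).elim
  · obtain ⟨M, hM, h⟩ := hQ.exists_mul_eq_mul (P := fun _ => 1) (S := conjQuad β)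
      (differentiable_const _) (differentiable_conjQuad β) (fun _ => (map_one _).symm)
      (conjQuad_conj β) hone (hscale _ _ (by simpa using hp) hq)
    exact ⟨M, hM, Or.inr (Or.inl ⟨β, hβ, hQ.eq_div_mul hM (eventually_conjQuad_ne_zero β)
      (fun _ _ _ => one_ne_zero) h⟩)⟩
  · obtain ⟨M, hM, h⟩ := hQ.exists_mul_eq_mul (P := conjQuad α) (S := fun _ => 1)
      (differentiable_conjQuad α) (differentiable_const _) (conjQuad_conj α)
      (fun _ => (map_one _).symm) (eventually_conjQuad_ne_zero α)
      (hscale _ _ hp (by simpa using hq))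
    refine ⟨M, hM, Or.inr (Or.inr ⟨α, hα, fun z hz => ?_⟩)⟩
    have h1 := h z hz
    rwa [mul_one] at h1
  · obtain ⟨M, hM, h⟩ := hQ.exists_mul_eq_mul (differentiable_conjQuad α)
      (differentiable_conjQuad β) (conjQuad_conj α) (conjQuad_conj β)
      (eventually_conjQuad_ne_zero α) (hscale _ _ hp hq)
    rcases eq_or_ne α β with rfl | hαβ
    · exact (hQ.not_forall_eq hM (eventually_conjQuad_ne_zero α) h).elim
    · exact ⟨M, hM, Or.inl ⟨α, β, hα, hβ, hαβ, hQ.eq_div_mul hM (eventually_conjQuad_ne_zero β)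
        (fun _ _ hz => conjQuad_ne_zero hα hβ hαβ hz) h⟩⟩
end

section
/- Let Q be a generalized Nevanlinna function with one negative square which extends holomorphically to an open neighborhood in ℂ of a point z₀ ∈ ℝ. If Q(z₀) = 0, then precisely one of the following five possibilities occurs: (0) Q′(z₀) > 0; (1) Q′(z₀) < 0; (2a) Q′(z₀) = 0 and Q″(z₀) > 0; (2b) Q′(z₀) = 0 and Q″(z₀) < 0; (3) Q′(z₀) = 0, Q″(z₀) = 0 and Q‴(z₀) > 0. -/
open Complex MeasureTheory Filter Set

open Topology

section Kernel

theorem nevKernel_isHermitian (Q : ℂ → ℂ) {n : ℕ} (z : Fin n → ℂ) :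
    (nevKernel Q z).IsHermitian := by
  ext i j
  simp only [nevKernel, Matrix.conjTranspose_apply, Matrix.of_apply, star_def, map_div₀, map_sub,
    conj_conj]
  rw [← neg_sub, ← neg_sub (z i), neg_div_neg_eq]

/-- A Hermitian `2 × 2` matrix with negative trace and positive determinant has two negative
eigenvalues. -/
theorem negEigCount_eq_two {A : Matrix (Fin 2) (Fin 2) ℂ} (hA : A.IsHermitian)
    (htr : A.trace.re < 0) (hdet : 0 < A.det.re) : negEigCount A = 2 := by
  rw [hA.trace_eq_sum_eigenvalues, Fin.sum_univ_two] at htr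
  rw [hA.det_eq_prod_eigenvalues, Fin.prod_univ_two] at hdet
  simp only [coe_algebraMap, add_re, mul_re, ofReal_re, ofReal_im, mul_zero, sub_zero] at htr hdet
  have h0 : hA.eigenvalues 0 < 0 := by
    by_contra! h
    nlinarith
  have h1 : hA.eigenvalues 1 < 0 := by
    by_contra! h
    nlinarith
  rw [negEigCount, dif_pos hA, Finset.filter_true_of_mem]
  · simp
  · intro i _
    fin_cases i
    · exact h0
    · exact h1

theorem negEigCount_nevKernel_pair {Q : ℂ → ℂ} {a b : ℂ} (ha : 0 < a.im) (hb : 0 < b.im)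
    (hQa : (Q a).im < 0) (hQb : (Q b).im < 0)
    (hdet : normSq (Q a - (starRingEnd ℂ) (Q b)) * (a.im * b.im) <
      (Q a).im * (Q b).im * normSq (a - (starRingEnd ℂ) b)) :
    negEigCount (nevKernel Q ![a, b]) = 2 := by
  have hab : 0 < normSq (a - (starRingEnd ℂ) b) := by
    rw [normSq_pos]
    intro h
    have := congrArg Complex.im h
    simp at this
    linarith
  have hdiag (w : ℂ) : (Q w - (starRingEnd ℂ) (Q w)) / (w - (starRingEnd ℂ) w)
      = (((Q w).im / w.im : ℝ) : ℂ) := by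
    rw [sub_conj, sub_conj]
    push_cast
    rw [mul_div_mul_right _ _ I_ne_zero, mul_div_mul_left _ _ two_ne_zero]
  have hoff : (Q a - (starRingEnd ℂ) (Q b)) / (a - (starRingEnd ℂ) b) *
      ((Q b - (starRingEnd ℂ) (Q a)) / (b - (starRingEnd ℂ) a)) =
      ((normSq (Q a - (starRingEnd ℂ) (Q b)) / normSq (a - (starRingEnd ℂ) b) : ℝ) : ℂ) := by
    push_cast
    rw [← mul_conj, ← mul_conj, map_sub, map_sub, conj_conj, conj_conj, div_mul_div_comm,
      ← neg_sub (Q b), ← neg_sub b, mul_neg, mul_neg, neg_div_neg_eq]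
  apply negEigCount_eq_two (nevKernel_isHermitian Q _)
  · simp only [nevKernel, Matrix.trace_fin_two, Matrix.of_apply, Matrix.cons_val_zero,
      Matrix.cons_val_one, hdiag, ← ofReal_add, ofReal_re]
    exact add_neg (div_neg_of_neg_of_pos hQa ha) (div_neg_of_neg_of_pos hQb hb)
  · simp only [nevKernel, Matrix.det_fin_two, Matrix.of_apply, Matrix.cons_val_zero,
      Matrix.cons_val_one, hdiag, hoff, ← ofReal_mul, ← ofReal_sub, ofReal_re]
    rw [sub_pos, div_mul_div_comm, div_lt_div_iff₀ hab (mul_pos ha hb)]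
    exact hdet

end Kernel

section Domain

variable {Q : ℂ → ℂ} {D : Set ℂ}

theorem IsGenNevanlinnaOne.countable_compl (hQ : IsGenNevanlinnaOne Q D) :
    ({z : ℂ | z.im ≠ 0} \ D).Countable := by
  have := hQ.discrete_compl
  exact countable_coe_iff.mp countable_of_Lindelof_of_discrete

theorem IsGenNevanlinnaOne.isPreconnected_upper (hQ : IsGenNevanlinnaOne Q D) :
    IsPreconnected (D ∩ {z : ℂ | 0 < z.im}) := by
  let φ : ℂ → ℂ := fun w => ⟨w.re, Real.exp w.im⟩
  have hφ : Continuous φ := by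
    have : φ = fun w => equivRealProdCLM.symm (w.re, Real.exp w.im) := by
      ext w
      rw [equivRealProdCLM_symm_apply]
      exact mk_eq_add_mul_I _ _
    rw [this]
    fun_prop
  have hinj : Function.Injective φ := by
    intro w w' h
    have hre := congrArg Complex.re h
    have him := congrArg Complex.im h
    exact Complex.ext hre (Real.exp_injective him)
  have hcount : (φ ⁻¹' ({z : ℂ | z.im ≠ 0} \ D)).Countable :=
    hQ.countable_compl.preimage hinj
  have himage : φ '' (φ ⁻¹' ({z : ℂ | z.im ≠ 0} \ D))ᶜ = D ∩ {z : ℂ | 0 < z.im} := by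
    ext z
    constructor
    · rintro ⟨w, hw, rfl⟩
      have hpos : 0 < (φ w).im := Real.exp_pos _
      refine ⟨?_, hpos⟩
      by_contra hD
      exact hw ⟨hpos.ne', hD⟩
    · rintro ⟨hzD, hz⟩
      have hφz : φ ⟨z.re, Real.log z.im⟩ = z := Complex.ext rfl (Real.exp_log hz)
      refine ⟨⟨z.re, Real.log z.im⟩, ?_, hφz⟩
      rw [mem_compl_iff, mem_preimage, hφz]
      exact fun h => h.2 hzD
  rw [← himage]
  exact (hcount.isConnected_compl_of_one_lt_rank (by simp)).isPreconnected.image _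
    hφ.continuousOn

/-- Along two rays from a real point into the upper half-plane, arbitrarily small parameters give
points of the domain of `Q`. -/
theorem IsGenNevanlinnaOne.exists_ray_mem (hQ : IsGenNevanlinnaOne Q D) (x : ℝ) {u v : ℂ}
    (hu : 0 < u.im) (hv : 0 < v.im) {p : ℝ → Prop} (hp : ∀ᶠ t in 𝓝[>] (0 : ℝ), p t) :
    ∃ t : ℝ, 0 < t ∧ p t ∧ (x : ℂ) + t * u ∈ D ∧ (x : ℂ) + t * v ∈ D := by
  have hcount {w : ℂ} (hw : 0 < w.im) :
      ((fun t : ℝ => (x : ℂ) + t * w) ⁻¹' ({z : ℂ | z.im ≠ 0} \ D)).Countable := by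
    refine hQ.countable_compl.preimage fun s t h => ?_
    have hw0 : w ≠ 0 := fun h0 => by simp [h0] at hw
    simpa [hw0] using h
  have hdense := ((hcount hu).union (hcount hv)).dense_compl ℝ
  obtain ⟨ε, hε, hsub⟩ := mem_nhdsGT_iff_exists_Ioo_subset.mp hp
  obtain ⟨t, ht, htε⟩ := hdense.exists_mem_open isOpen_Ioo (nonempty_Ioo.mpr hε)
  rw [mem_compl_iff, mem_union, not_or] at ht
  have hmem {w : ℂ} (hw : 0 < w.im)
      (h : t ∉ (fun t : ℝ => (x : ℂ) + t * w) ⁻¹' ({z : ℂ | z.im ≠ 0} \ D)) :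
      (x : ℂ) + t * w ∈ D := by
    by_contra hD
    refine h ⟨?_, hD⟩
    simpa using ⟨htε.1.ne', hw.ne'⟩
  exact ⟨t, htε.1, hsub htε, hmem hu ht.1, hmem hv ht.2⟩

theorem IsGenNevanlinnaOne.not_eventuallyEq_zero (hQ : IsGenNevanlinnaOne Q D) {a : ℂ}
    (haD : a ∈ D) (ha : 0 < a.im) : ¬ Q =ᶠ[𝓝 a] 0 := by
  intro h
  have hQan : AnalyticOnNhd ℂ Q (D ∩ {z : ℂ | 0 < z.im}) :=
    (hQ.holo.analyticOnNhd hQ.isOpen).mono inter_subset_left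
  have hzero := hQan.eqOn_zero_of_preconnected_of_eventuallyEq_zero hQ.isPreconnected_upper
    ⟨haD, ha⟩ h
  obtain ⟨n, z, hz, hcard⟩ := hQ.exists_one
  have hker : nevKernel Q z = 0 := by
    ext i j
    have hi : Q (z i) = 0 := hzero (hz i)
    have hj : Q (z j) = 0 := hzero (hz j)
    simp [nevKernel, hi, hj]
  have hherm : (0 : Matrix (Fin n) (Fin n) ℂ).IsHermitian := Matrix.isHermitian_zero
  have heig : hherm.eigenvalues = 0 := hherm.eigenvalues_eq_zero_iff.mpr rfl
  rw [hker, negEigCount, dif_pos hherm] at hcard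
  simp [heig] at hcard

end Domain

section Jet

theorem iteratedDeriv_eq_factorial_mul {f g : ℂ → ℂ} {a : ℂ} (k : ℕ) (hg : AnalyticAt ℂ g a)
    (h : f =ᶠ[𝓝 a] fun z => (z - a) ^ k * g z) :
    iteratedDeriv k f a = k.factorial * g a := by
  induction k generalizing f g with
  | zero => simpa using h.self_of_nhds
  | succ k ih =>
    have hderiv : deriv f =ᶠ[𝓝 a] fun z => (z - a) ^ k * ((k + 1) * g z + (z - a) * deriv g z) := by
      refine h.deriv.trans ?_
      filter_upwards [hg.eventually_analyticAt] with z hz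
      have hpow : HasDerivAt (fun z => (z - a) ^ (k + 1)) ((k + 1) * (z - a) ^ k) z := by
        simpa using ((hasDerivAt_id' z).sub_const a).fun_pow (k + 1)
      rw [(hpow.fun_mul hz.differentiableAt.hasDerivAt).deriv]
      ring
    have han : AnalyticAt ℂ (fun z => (k + 1) * g z + (z - a) * deriv g z) a := by
      have := hg.deriv
      fun_prop
    rw [iteratedDeriv_succ', ih han hderiv, Nat.factorial_succ]
    push_cast
    ring

theorem iteratedDeriv_eq_zero_of_lt {f g : ℂ → ℂ} {a : ℂ} {k m : ℕ} (hkm : k < m)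
    (hg : AnalyticAt ℂ g a) (h : f =ᶠ[𝓝 a] fun z => (z - a) ^ m * g z) :
    iteratedDeriv k f a = 0 := by
  have han : AnalyticAt ℂ (fun z => (z - a) ^ (m - k) * g z) a := by fun_prop
  rw [iteratedDeriv_eq_factorial_mul k han]
  · simp [Nat.sub_ne_zero_of_lt hkm]
  · filter_upwards [h] with z hz
    rw [hz, ← mul_assoc, ← pow_add, Nat.add_sub_cancel' hkm.le]

end Jet

section Rays

theorem exists_two_upper_pow_eq {m : ℕ} {θ : ℝ} (hθ : 0 < θ) (hm : θ + 2 * Real.pi < m * Real.pi) :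
    ∃ u v : ℂ, 0 < u.im ∧ 0 < v.im ∧ u ≠ v ∧ u ^ m = exp (θ * I) ∧ v ^ m = exp (θ * I) := by
  have hπ := Real.pi_pos
  have hm0 : (0 : ℝ) < m := by
    by_contra! h
    nlinarith
  have hmC : (m : ℂ) ≠ 0 := by exact_mod_cast hm0.ne'
  have him {α : ℝ} (h0 : 0 < α) (h1 : α < m * Real.pi) : 0 < (exp (((α / m : ℝ) : ℂ) * I)).im := by
    rw [exp_ofReal_mul_I_im]
    exact Real.sin_pos_of_pos_of_lt_pi (by positivity) (by rwa [div_lt_iff₀' hm0])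
  have hpow (α : ℝ) : exp (((α / m : ℝ) : ℂ) * I) ^ m = exp (α * I) := by
    rw [← exp_nat_mul]
    congr 1
    push_cast
    field_simp
  refine ⟨exp (((θ / m : ℝ) : ℂ) * I), exp ((((θ + 2 * Real.pi) / m : ℝ) : ℂ) * I),
    him hθ (by linarith), him (by linarith) hm, ?_, hpow _, ?_⟩
  · intro h
    have hre := congrArg Complex.re h
    rw [exp_ofReal_mul_I_re, exp_ofReal_mul_I_re] at hre
    have hlt : θ / m < (θ + 2 * Real.pi) / m := by
      gcongr
      linarith
    have hcos := Real.cos_lt_cos_of_nonneg_of_le_pi (by positivity)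
      ((div_le_iff₀' hm0).mpr hm.le) hlt
    exact hcos.ne' hre
  · rw [hpow]
    push_cast
    rw [add_mul, exp_periodic]

theorem tendsto_ray (x : ℝ) (w : ℂ) :
    Tendsto (fun t : ℝ => (x : ℂ) + t * w) (𝓝[>] 0) (𝓝 (x : ℂ)) := by
  have h : Continuous fun t : ℝ => (x : ℂ) + t * w := by fun_prop
  simpa using (h.tendsto 0).mono_left nhdsWithin_le_nhds

end Rays

section Local

variable {Q Qe g : ℂ → ℂ} {D V : Set ℂ} {x : ℝ} {m : ℕ}

theorem IsGenNevanlinnaOne.conj_leading_coeff (hQ : IsGenNevanlinnaOne Q D)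
    (hV : V ∈ 𝓝 (x : ℂ)) (hagree : ∀ z ∈ V ∩ D, Qe z = Q z) (hg : ContinuousAt g x)
    (hfac : ∀ᶠ z in 𝓝 (x : ℂ), Qe z = (z - x) ^ m * g z) :
    (starRingEnd ℂ) (g x) = g x := by
  by_contra hne
  have hconj : Tendsto (fun t : ℝ => (starRingEnd ℂ) (g (x + t * I))) (𝓝[>] 0)
      (𝓝 ((starRingEnd ℂ) (g x))) :=
    (continuous_conj.tendsto _).comp (hg.tendsto.comp (tendsto_ray x I))
  have hev := (hconj.prodMk_nhds (hg.tendsto.comp (tendsto_ray x (-I)))).eventually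
    ((isOpen_ne_fun continuous_fst continuous_snd).mem_nhds hne)
  have hgood := hfac.and hV
  obtain ⟨t, ht, ⟨htne, ⟨hf₁, hV₁⟩, hf₂, hV₂⟩, hD, -⟩ := hQ.exists_ray_mem x (u := I) (v := I)
    (by simp) (by simp)
    (hev.and (((tendsto_ray x I).eventually hgood).and ((tendsto_ray x (-I)).eventually hgood)))
  have hpt : (starRingEnd ℂ) ((x : ℂ) + t * I) = x + t * -I := by simp
  have hsymm := hQ.symm _ hD
  rw [hpt, ← hagree _ ⟨hV₁, hD⟩, ← hagree _ ⟨hV₂, hpt ▸ hQ.conj_mem _ hD⟩, hf₁, hf₂] at hsymm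
  have hpow : ((t : ℂ) * -I) ^ m ≠ 0 := by simp [ht.ne']
  simp only [add_sub_cancel_left, map_mul, map_pow, conj_ofReal, conj_I] at hsymm
  exact htne (mul_left_cancel₀ hpow hsymm).symm

/-- If two rays are mapped, to leading order, to the same negative imaginary value, then the kernel
has two negative squares. -/
theorem IsGenNevanlinnaOne.leading_ray_nonneg (hQ : IsGenNevanlinnaOne Q D)
    (hV : V ∈ 𝓝 (x : ℂ)) (hagree : ∀ z ∈ V ∩ D, Qe z = Q z) (hg : ContinuousAt g x)
    (hfac : ∀ᶠ z in 𝓝 (x : ℂ), Qe z = (z - x) ^ m * g z) {u v : ℂ} (hu : 0 < u.im)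
    (hv : 0 < v.im) (huv : u ≠ v) {r : ℝ} (hur : u ^ m * g x = r * I) (hvr : v ^ m * g x = r * I) :
    0 ≤ r := by
  by_contra! hr
  have hlim {w : ℂ} (hw : w ^ m * g x = r * I) :
      Tendsto (fun t : ℝ => w ^ m * g (x + t * w)) (𝓝[>] 0) (𝓝 (r * I)) := by
    rw [← hw]
    exact (hg.tendsto.comp (tendsto_ray x w)).const_mul _
  have hev : ∀ᶠ p : ℂ × ℂ in 𝓝 (r * I, r * I), p.1.im < 0 ∧ p.2.im < 0 ∧
      normSq (p.1 - (starRingEnd ℂ) p.2) * (u.im * v.im) <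
        p.1.im * p.2.im * normSq (u - (starRingEnd ℂ) v) := by
    have hopen : IsOpen {p : ℂ × ℂ | p.1.im < 0 ∧ p.2.im < 0 ∧
        normSq (p.1 - (starRingEnd ℂ) p.2) * (u.im * v.im) <
          p.1.im * p.2.im * normSq (u - (starRingEnd ℂ) v)} := by
      have hcont : Continuous fun p : ℂ × ℂ => normSq (p.1 - (starRingEnd ℂ) p.2) :=
        continuous_normSq.comp (by fun_prop)
      simp only [ofPred_and]
      refine .inter ?_ (.inter ?_ ?_) <;> exact isOpen_lt (by fun_prop) (by fun_prop)
    refine hopen.mem_nhds ⟨by simpa using hr, by simpa using hr, ?_⟩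
    have hpos : 0 < (u.re - v.re) ^ 2 + (u.im - v.im) ^ 2 := by
      by_contra! h
      refine huv (Complex.ext ?_ ?_) <;> nlinarith [sq_nonneg (u.re - v.re), sq_nonneg (u.im - v.im)]
    simp [normSq_apply]
    nlinarith [mul_pos (mul_pos_of_neg_of_neg hr hr) hpos]
  have hevt := ((hlim hur).prodMk_nhds (hlim hvr)).eventually hev
  have hgood := hfac.and hV
  obtain ⟨t, ht, ⟨⟨him₁, him₂, hdet⟩, ⟨hf₁, hV₁⟩, hf₂, hV₂⟩, hD₁, hD₂⟩ := hQ.exists_ray_mem x hu hv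
    (hevt.and (((tendsto_ray x u).eventually hgood).and ((tendsto_ray x v).eventually hgood)))
  dsimp only at him₁ him₂ hdet
  have htm : 0 < t ^ m := pow_pos ht m
  have hQ₁ : Q (x + t * u) = ((t ^ m : ℝ) : ℂ) * (u ^ m * g (x + t * u)) := by
    rw [← hagree _ ⟨hV₁, hD₁⟩, hf₁]
    push_cast
    ring
  have hQ₂ : Q (x + t * v) = ((t ^ m : ℝ) : ℂ) * (v ^ m * g (x + t * v)) := by
    rw [← hagree _ ⟨hV₂, hD₂⟩, hf₂]
    push_cast
    ring
  have hpos {w : ℂ} (hw : 0 < w.im) : 0 < ((x : ℂ) + t * w).im := by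
    simpa using mul_pos ht hw
  have htwo : negEigCount (nevKernel Q ![(x : ℂ) + t * u, (x : ℂ) + t * v]) = 2 := by
    apply negEigCount_nevKernel_pair (hpos hu) (hpos hv)
    · rw [hQ₁, im_ofReal_mul]
      exact mul_neg_of_pos_of_neg htm him₁
    · rw [hQ₂, im_ofReal_mul]
      exact mul_neg_of_pos_of_neg htm him₂
    · have hz : (x : ℂ) + t * u - (starRingEnd ℂ) (x + t * v) = t * (u - (starRingEnd ℂ) v) := by
        simp
        ring
      rw [hQ₁, hQ₂, map_mul, conj_ofReal, ← mul_sub, hz, normSq_mul, normSq_mul, normSq_ofReal,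
        normSq_ofReal, im_ofReal_mul, im_ofReal_mul]
      simp only [add_im, ofReal_im, zero_add, im_ofReal_mul]
      have := mul_lt_mul_of_pos_left hdet (by positivity : 0 < t ^ m * t ^ m * (t * t))
      linarith
  have hle := hQ.le_one 2 ![(x : ℂ) + t * u, (x : ℂ) + t * v] fun i => by
    fin_cases i
    · exact ⟨hD₁, hpos hu⟩
    · exact ⟨hD₂, hpos hv⟩
  omega

theorem IsGenNevanlinnaOne.leading_coeff_nonneg (hQ : IsGenNevanlinnaOne Q D)
    (hV : V ∈ 𝓝 (x : ℂ)) (hagree : ∀ z ∈ V ∩ D, Qe z = Q z) (hg : ContinuousAt g x)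
    (hfac : ∀ᶠ z in 𝓝 (x : ℂ), Qe z = (z - x) ^ m * g z) {c : ℝ} (hc : g x = c) (hm : 3 ≤ m) :
    0 ≤ c := by
  have hm' : (3 : ℝ) ≤ m := by exact_mod_cast hm
  obtain ⟨u, v, hu, hv, huv, hum, hvm⟩ := exists_two_upper_pow_eq (m := m) (θ := Real.pi / 2)
    (by positivity) (by nlinarith [Real.pi_pos])
  have hexp : exp (((Real.pi / 2 : ℝ) : ℂ) * I) = I := by
    push_cast
    exact exp_pi_div_two_mul_I
  refine hQ.leading_ray_nonneg hV hagree hg hfac hu hv huv ?_ ?_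
  · rw [hum, hc, hexp, mul_comm]
  · rw [hvm, hc, hexp, mul_comm]

theorem IsGenNevanlinnaOne.leading_coeff_nonpos (hQ : IsGenNevanlinnaOne Q D)
    (hV : V ∈ 𝓝 (x : ℂ)) (hagree : ∀ z ∈ V ∩ D, Qe z = Q z) (hg : ContinuousAt g x)
    (hfac : ∀ᶠ z in 𝓝 (x : ℂ), Qe z = (z - x) ^ m * g z) {c : ℝ} (hc : g x = c) (hm : 4 ≤ m) :
    c ≤ 0 := by
  have hm' : (4 : ℝ) ≤ m := by exact_mod_cast hm
  obtain ⟨u, v, hu, hv, huv, hum, hvm⟩ := exists_two_upper_pow_eq (m := m)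
    (θ := Real.pi / 2 + Real.pi) (by positivity) (by nlinarith [Real.pi_pos])
  have hexp : exp (((Real.pi / 2 + Real.pi : ℝ) : ℂ) * I) = -I := by
    push_cast
    rw [add_mul, exp_add, exp_pi_div_two_mul_I, exp_pi_mul_I, mul_neg_one]
  have := hQ.leading_ray_nonneg hV hagree hg hfac hu hv huv (r := -c)
    (by rw [hum, hc, hexp]; push_cast; ring) (by rw [hvm, hc, hexp]; push_cast; ring)
  linarith

end Local

/-- Let `Q` be a generalized Nevanlinna function with one negative
square which extends holomorphically (as `Qe`) to an open neighborhood `V` of a point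
`z₀ ∈ ℝ`. If `Q(z₀) = 0`, then precisely one of the five listed sign possibilities
for the first three derivatives at `z₀` occurs (the five cases are pairwise mutually
exclusive, so the disjunction expresses this). -/
theorem statement3 (Q : ℂ → ℂ) (D : Set ℂ) (hQ : IsGenNevanlinnaOne Q D)
    (z₀ : ℝ) (Qe : ℂ → ℂ) (V : Set ℂ) (hV : IsOpen V) (hz₀ : (z₀ : ℂ) ∈ V)
    (hQe : DifferentiableOn ℂ Qe V) (hagree : ∀ z ∈ V ∩ D, Qe z = Q z)
    (h0 : Qe z₀ = 0) :
    (∃ r : ℝ, 0 < r ∧ deriv Qe z₀ = r) ∨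
    (∃ r : ℝ, r < 0 ∧ deriv Qe z₀ = r) ∨
    (deriv Qe z₀ = 0 ∧ ∃ r : ℝ, 0 < r ∧ iteratedDeriv 2 Qe z₀ = r) ∨
    (deriv Qe z₀ = 0 ∧ ∃ r : ℝ, r < 0 ∧ iteratedDeriv 2 Qe z₀ = r) ∨
    (deriv Qe z₀ = 0 ∧ iteratedDeriv 2 Qe z₀ = 0 ∧
      ∃ r : ℝ, 0 < r ∧ iteratedDeriv 3 Qe z₀ = r) := by
  have hVn : V ∈ 𝓝 (z₀ : ℂ) := hV.mem_nhds hz₀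
  have hnz : ¬ ∀ᶠ z in 𝓝 (z₀ : ℂ), Qe z = 0 := by
    intro hz
    obtain ⟨t, ht, ⟨hzero, htV⟩, htD, -⟩ := hQ.exists_ray_mem z₀ (u := I) (v := I)
      (by simp) (by simp) (((tendsto_ray z₀ I).eventually hz.eventually_nhds).and
        ((tendsto_ray z₀ I).eventually hVn))
    refine hQ.not_eventuallyEq_zero htD (by simpa using ht) ?_
    filter_upwards [hzero, hV.mem_nhds htV, hQ.isOpen.mem_nhds htD] with z h hzV hzD
    rw [← hagree z ⟨hzV, hzD⟩, h, Pi.zero_apply]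
  obtain ⟨m, g, hg, hg0, hfac⟩ :=
    (hQe.analyticAt hVn).exists_eventuallyEq_pow_smul_nonzero_iff.mpr hnz
  simp only [smul_eq_mul] at hfac
  obtain ⟨c, hc⟩ := conj_eq_iff_real.mp (hQ.conj_leading_coeff hVn hagree hg.continuousAt hfac)
  have hc0 : c ≠ 0 := by
    rintro rfl
    simp [hc] at hg0
  have hlead := iteratedDeriv_eq_factorial_mul m hg hfac
  have hlow {k : ℕ} (hk : k < m) : iteratedDeriv k Qe z₀ = 0 := iteratedDeriv_eq_zero_of_lt hk hg hfac
  rw [hc] at hlead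
  rw [← iteratedDeriv_one]
  obtain rfl | rfl | rfl | rfl | hm : m = 0 ∨ m = 1 ∨ m = 2 ∨ m = 3 ∨ 4 ≤ m := by omega
  · simp [h0] at hlead
    exact absurd (by exact_mod_cast hlead.symm) hc0
  · rw [hlead]
    rcases hc0.lt_or_gt with h | h
    · exact Or.inr (Or.inl ⟨c, h, by simp⟩)
    · exact Or.inl ⟨c, h, by simp⟩
  · rw [hlead]
    rcases hc0.lt_or_gt with h | h
    · exact Or.inr (Or.inr (Or.inr (Or.inl ⟨hlow one_lt_two, 2 * c, by linarith, by simp⟩)))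
    · exact Or.inr (Or.inr (Or.inl ⟨hlow one_lt_two, 2 * c, by linarith, by simp⟩))
  · have hpos : 0 < c :=
      (hQ.leading_coeff_nonneg hVn hagree hg.continuousAt hfac hc le_rfl).lt_of_ne' hc0
    exact Or.inr (Or.inr (Or.inr (Or.inr ⟨hlow (by norm_num), hlow (by norm_num), 6 * c,
      by linarith, by rw [hlead]; simp [Nat.factorial]⟩)))
  · exact absurd (le_antisymm (hQ.leading_coeff_nonpos hVn hagree hg.continuousAt hfac hc hm)
      (hQ.leading_coeff_nonneg hVn hagree hg.continuousAt hfac hc (by omega))) hc0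
end

section
/- Let Q be holomorphic at z₀ ∈ ℂ with Q^{(i)}(z₀) = 0 for 0 ≤ i ≤ n−1 and Q^{(n)}(z₀) ≠ 0, for some n ≥ 1. Then there exist a neighborhood V of z₀, a neighborhood W of 0, and n functions φ¹,…,φⁿ holomorphic on W with φ^i(0) = z₀, such that: (a) Q(φ^i(w)) = wⁿ for all w ∈ W and each i; (b) the derivatives (φ^i)′(0), 1 ≤ i ≤ n, are exactly the n distinct roots of the equation ζⁿ = n!/Q^{(n)}(z₀); (c) for every w ∈ W with w ≠ 0, every solution z ∈ V of Q(z) = wⁿ equals φ^i(w) for some i. -/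
open Complex Filter Set

/-- An analytic function that does not vanish at `z₀` has an `n`-th root that is analytic
at `z₀`. -/
theorem AnalyticAt.exists_pow_eq {g : ℂ → ℂ} {z₀ : ℂ} (hg : AnalyticAt ℂ g z₀)
    (hg₀ : g z₀ ≠ 0) {n : ℕ} (hn : n ≠ 0) :
    ∃ r : ℂ → ℂ, AnalyticAt ℂ r z₀ ∧ ∀ z, r z ^ n = g z := by
  obtain ⟨c, hc⟩ := IsAlgClosed.exists_pow_nat_eq (g z₀) (Nat.pos_of_ne_zero hn)
  refine ⟨fun z => c * (g z / g z₀) ^ ((n : ℂ)⁻¹), ?_, fun z => ?_⟩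
  · refine analyticAt_const.mul ((hg.div analyticAt_const hg₀).cpow analyticAt_const ?_)
    simp [hg₀]
  · rw [mul_pow, cpow_nat_inv_pow _ hn, hc, mul_div_cancel₀ _ hg₀]

/-- A function analytic at `z₀` with a zero of exact order `n` there is the `n`-th power of a
function analytic at `z₀`, whose derivative is an `n`-th root of the leading Taylor coefficient. -/
theorem AnalyticAt.exists_eq_pow_of_iteratedDeriv {Q : ℂ → ℂ} {z₀ : ℂ} {n : ℕ}
    (hn : n ≠ 0) (hQ : AnalyticAt ℂ Q z₀) (hvan : ∀ i < n, iteratedDeriv i Q z₀ = 0)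
    (hder : iteratedDeriv n Q z₀ ≠ 0) :
    ∃ P : ℂ → ℂ, AnalyticAt ℂ P z₀ ∧ P z₀ = 0 ∧ (∀ z, Q z = P z ^ n) ∧
      deriv P z₀ ^ n = iteratedDeriv n Q z₀ / (n.factorial : ℂ) := by
  have hQ₀ : AnalyticAt ℂ (fun z => Q (z₀ + z)) 0 :=
    AnalyticAt.fun_comp (g := Q) (by simpa using hQ) (by fun_prop)
  obtain ⟨F, hF, hQF⟩ := hQ₀.exists_eq_sum_add_pow_mul (n + 1)
  have hFz₀ : AnalyticAt ℂ (fun z => F (z - z₀)) z₀ :=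
    AnalyticAt.fun_comp (g := F) (by simpa using hF) (by fun_prop)
  have hfac : (n.factorial : ℂ) ≠ 0 := mod_cast n.factorial_ne_zero
  have hg : AnalyticAt ℂ
      (fun z => iteratedDeriv n Q z₀ / (n.factorial : ℂ) + (z - z₀) * F (z - z₀)) z₀ :=
    analyticAt_const.fun_add (AnalyticAt.fun_mul (by fun_prop) hFz₀)
  obtain ⟨r, hr, hrg⟩ := hg.exists_pow_eq (by simp [hder, hfac]) hn
  have hP : HasDerivAt (fun z => (z - z₀) * r z) (r z₀) z₀ := by
    simpa using ((hasDerivAt_id z₀).sub_const z₀).fun_mul hr.differentiableAt.hasDerivAt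
  refine ⟨fun z => (z - z₀) * r z, by fun_prop, by simp, ?_, ?_⟩
  · intro z
    have hz := hQF (z - z₀)
    simp only [iteratedDeriv_comp_const_add, add_zero, add_sub_cancel] at hz
    rw [hz, mul_pow, hrg, Finset.sum_range_succ, Finset.sum_eq_zero]
    · simp only [smul_eq_mul]
      field_simp
      ring
    · intro i hi
      simp [hvan i (Finset.mem_range.mp hi)]
  · rw [hP.deriv, hrg]
    simp

/-- branches of the inverse function theorem. If `Q` is holomorphic
at `z₀` with `Q⁽ⁱ⁾(z₀) = 0` for `0 ≤ i ≤ n−1` and `Q⁽ⁿ⁾(z₀) ≠ 0`, then near `z₀` the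
equation `Q(z) = wⁿ` has `n` holomorphic branches of solutions `φ¹, …, φⁿ` with
`φⁱ(0) = z₀`, whose derivatives at `0` are exactly the `n` distinct roots of
`ζⁿ = n!/Q⁽ⁿ⁾(z₀)`, and every local solution lies on one of the branches. -/
theorem statement4 (Q : ℂ → ℂ) (z₀ : ℂ) (n : ℕ) (hn : 1 ≤ n)
    (hQ : AnalyticAt ℂ Q z₀)
    (hvan : ∀ i < n, iteratedDeriv i Q z₀ = 0)
    (hder : iteratedDeriv n Q z₀ ≠ 0) :
    ∃ V W : Set ℂ, IsOpen V ∧ z₀ ∈ V ∧ IsOpen W ∧ (0 : ℂ) ∈ W ∧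
      ∃ φ : Fin n → ℂ → ℂ,
        (∀ i, DifferentiableOn ℂ (φ i) W ∧ φ i 0 = z₀) ∧
        (∀ i, ∀ w ∈ W, Q (φ i w) = w ^ n) ∧
        Function.Injective (fun i => deriv (φ i) 0) ∧
        (∀ i, deriv (φ i) 0 ^ n = (n.factorial : ℂ) / iteratedDeriv n Q z₀) ∧
        (∀ w ∈ W, w ≠ 0 → ∀ z ∈ V, Q z = w ^ n → ∃ i, z = φ i w) := by
  have hn₀ : n ≠ 0 := Nat.one_le_iff_ne_zero.mp hn
  have : NeZero n := ⟨hn₀⟩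
  obtain ⟨P, hP, hP₀, hQP, hPd⟩ := hQ.exists_eq_pow_of_iteratedDeriv hn₀ hvan hder
  have hP' : deriv P z₀ ≠ 0 := by
    intro h0
    rw [h0, zero_pow hn₀, eq_comm, div_eq_zero_iff] at hPd
    exact hPd.elim hder (mod_cast n.factorial_ne_zero)
  have hs := hP.hasStrictDerivAt
  set ψ := hs.localInverse P (deriv P z₀) z₀ hP'
  have hψ : AnalyticAt ℂ ψ 0 := hP₀ ▸ hP.analyticAt_localInverse hP'
  have hψ₀ : ψ 0 = z₀ := hP₀ ▸ HasStrictFDerivAt.localInverse_apply_image ..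
  have hψd : HasDerivAt ψ (deriv P z₀)⁻¹ 0 := hP₀ ▸ (hs.to_localInverse hP').hasDerivAt
  have hleft : ∀ᶠ z in nhds z₀, ψ (P z) = z := hs.eventually_left_inverse hP'
  have hright : ∀ᶠ u in nhds 0, P (ψ u) = u := hP₀ ▸ hs.eventually_right_inverse hP'
  obtain ⟨V, hV, hVo, hzV⟩ := eventually_nhds_iff.mp hleft
  obtain ⟨ε, hε, hball⟩ := Metric.eventually_nhds_iff_ball.mp
    (hψ.eventually_analyticAt.and hright)
  have hζ := isPrimitiveRoot_exp n hn₀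
  set ζ := exp (2 * Real.pi * I / n)
  have hmem (i : ℕ) {w : ℂ} (hw : w ∈ Metric.ball 0 ε) : ζ ^ i * w ∈ Metric.ball 0 ε := by
    simpa [hζ.norm'_eq_one hn₀] using hw
  have hφd (i : ℕ) : deriv (fun w => ψ (ζ ^ i * w)) 0 = (deriv P z₀)⁻¹ * ζ ^ i := by
    have h1 : HasDerivAt (fun w : ℂ => ζ ^ i * w) (ζ ^ i) 0 := by
      simpa using (hasDerivAt_id (0 : ℂ)).const_mul (ζ ^ i)
    exact (HasDerivAt.comp (h₂ := ψ) 0 (by simpa using hψd) h1).deriv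
  refine ⟨V, Metric.ball 0 ε, hVo, hzV, Metric.isOpen_ball, Metric.mem_ball_self hε,
    fun i w => ψ (ζ ^ (i : ℕ) * w), fun i => ⟨fun w hw => ?_, by simpa using hψ₀⟩,
    fun i w hw => ?_, fun i j hij => ?_, fun i => ?_, fun w _ hw₀ z hz hQz => ?_⟩
  · exact (DifferentiableAt.comp (g := ψ) w (hball _ (hmem i hw)).1.differentiableAt
      (by fun_prop)).differentiableWithinAt
  · rw [hQP, (hball _ (hmem i hw)).2, mul_pow, pow_right_comm, hζ.pow_eq_one, one_pow, one_mul]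
  · simp only [hφd] at hij
    exact Fin.ext (hζ.pow_inj i.2 j.2 (mul_left_cancel₀ (inv_ne_zero hP') hij))
  · rw [hφd, mul_pow, pow_right_comm, hζ.pow_eq_one, one_pow, mul_one, inv_pow, hPd, inv_div]
  · have hroot : (P z / w) ^ n = 1 := by
      rw [div_pow, ← hQP, hQz, div_self (pow_ne_zero n hw₀)]
    obtain ⟨i, hi, hiw⟩ := hζ.eq_pow_of_pow_eq_one hroot
    exact ⟨⟨i, hi⟩, by simp only [hiw, div_mul_cancel₀ _ hw₀, hV z hz]⟩
end

section
/- Let Q be holomorphic on an open set U ⊆ ℂ containing a point z₀ ∈ ℝ, with Q real-valued on U ∩ ℝ. Assume Q(z₀) = 0, Q′(z₀) = 0 and Q″(z₀) > 0. Then there exist ε₁ > 0, ε₂ > 0 and a continuous function α : (−ε₁, ε₂) → ℂ with α(0) = z₀ such that: (a) Q(α(τ)) = τ for all τ ∈ (−ε₁, ε₂); (b) α is real-analytic on (−ε₁, 0) and on (0, ε₂); (c) α(τ) ∈ ℝ and Q′(α(τ)) < 0 for τ ∈ (0, ε₂); (d) α(τ) ∈ ℂ⁺ for τ ∈ (−ε₁,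 0); (e) arg(α(τ) − z₀) → π/2 as τ ↑ 0. -/
open Complex Filter Set

open scoped Topology

/-- An analytic function with a double zero at `z₀` is `(z - z₀)²` times an analytic function
whose value at `z₀` is half the second derivative. -/
theorem AnalyticAt.exists_eq_sq_mul {f : ℂ → ℂ} {z₀ : ℂ} (hf : AnalyticAt ℂ f z₀)
    (h0 : f z₀ = 0) (h1 : deriv f z₀ = 0) :
    ∃ g : ℂ → ℂ, AnalyticAt ℂ g z₀ ∧ (∀ z, f z = (z - z₀) ^ 2 * g z) ∧
      iteratedDeriv 2 f z₀ = 2 * g z₀ := by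
  obtain ⟨p, hp⟩ := hf
  have hg : AnalyticAt ℂ (dslope (dslope f z₀) z₀) z₀ :=
    ⟨_, hp.has_fpower_series_dslope_fslope.has_fpower_series_dslope_fslope⟩
  have hfac : ∀ z, f z = (z - z₀) ^ 2 * dslope (dslope f z₀) z₀ z := by
    intro z
    have e1 := sub_smul_dslope f z₀ z
    have e2 := sub_smul_dslope (dslope f z₀) z₀ z
    rw [dslope_same, h1, sub_zero, smul_eq_mul] at e2
    rw [h0, sub_zero, smul_eq_mul, ← e2] at e1
    rw [← e1]
    ring
  refine ⟨_, hg, hfac, ?_⟩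
  generalize dslope (dslope f z₀) z₀ = g at hg hfac
  have hderiv : deriv f =ᶠ[𝓝 z₀] fun z => 2 * (z - z₀) * g z + (z - z₀) ^ 2 * deriv g z := by
    filter_upwards [hg.eventually_analyticAt] with z hz
    rw [funext hfac]
    have := (((hasDerivAt_id z).sub_const z₀).pow 2).mul hz.differentiableAt.hasDerivAt
    refine HasDerivAt.deriv (this.congr_deriv ?_)
    simp
  rw [iteratedDeriv_succ, iteratedDeriv_one, hderiv.deriv_eq]
  have hid := (hasDerivAt_id z₀).sub_const z₀
  have := ((hid.const_mul 2).mul hg.differentiableAt.hasDerivAt).add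
    ((hid.pow 2).mul hg.deriv.differentiableAt.hasDerivAt)
  refine HasDerivAt.deriv (this.congr_deriv ?_)
  simp

/-- The complex derivative at a real point of a function that is real on nearby reals is real. -/
theorem Complex.im_deriv_eq_zero_of_eventually_real {f : ℂ → ℂ} {x : ℝ}
    (hf : DifferentiableAt ℂ f x) (hreal : ∀ᶠ t : ℝ in 𝓝 x, (f t).im = 0) :
    (deriv f x).im = 0 := by
  have h1 : HasDerivAt (fun t : ℝ => (f t).im) (deriv f x).im x :=
    imCLM.hasFDerivAt.comp_hasDerivAt x hf.hasDerivAt.comp_ofReal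
  exact h1.unique ((hasDerivAt_const x (0 : ℝ)).congr_of_eventuallyEq hreal)

/-- A local inverse of a function that is real on the real line near `x` is itself real on the
real line near the image of `x`. -/
theorem Complex.eventually_im_eq_zero_of_leftInverse {h r : ℂ → ℂ} {x y : ℝ}
    (hh : AnalyticAt ℂ h x) (hxy : h x = y) (hd : (deriv h x).re ≠ 0)
    (hreal : ∀ᶠ t : ℝ in 𝓝 x, (h t).im = 0) (hr : ∀ᶠ z in 𝓝 (x : ℂ), r (h z) = z) :
    ∀ᶠ t : ℝ in 𝓝 y, (r t).im = 0 := by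
  have hs : HasStrictDerivAt (fun t : ℝ => (h t).re) (deriv h x).re x :=
    hh.hasStrictDerivAt.real_of_complex
  have hmap := hs.map_nhds_eq hd
  simp only [hxy, ofReal_re] at hmap
  rw [← hmap, eventually_map]
  filter_upwards [hreal, (continuous_ofReal.tendsto x).eventually hr] with t ht hrt
  have : (((h t).re : ℝ) : ℂ) = h t := Complex.ext (by simp) (by simp [ht])
  rw [this, hrt, ofReal_im]

/-- Near a real double zero with positive second derivative, a function that is real on the real
line is the square of a local coordinate; `r` is the inverse of that coordinate. -/
theorem Complex.exists_inverse_sq_coordinate {f : ℂ → ℂ} {x₀ : ℝ} (hf : AnalyticAt ℂ f x₀)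
    (hreal : ∀ᶠ x : ℝ in 𝓝 x₀, (f x).im = 0) (h0 : f x₀ = 0) (h1 : deriv f x₀ = 0)
    (h2_im : (iteratedDeriv 2 f x₀).im = 0) (h2_pos : 0 < (iteratedDeriv 2 f x₀).re) :
    ∃ r : ℂ → ℂ, AnalyticAt ℂ r 0 ∧ r 0 = x₀ ∧ (∀ᶠ w in 𝓝 0, f (r w) = w ^ 2) ∧
      (∀ᶠ t : ℝ in 𝓝 0, (r t).im = 0) ∧ ∃ a : ℝ, 0 < a ∧ deriv r 0 = a := by
  obtain ⟨g, hg, hfac, hg2⟩ := hf.exists_eq_sq_mul h0 h1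
  have hg_re : 0 < (g x₀).re := by simpa [hg2] using h2_pos
  have hg_im : (g x₀).im = 0 := by simpa [hg2] using h2_im
  have hg_slit : g x₀ ∈ slitPlane := Or.inl hg_re
  set s : ℂ → ℂ := fun z => exp (log (g z) / 2) with hs
  have hs_an : AnalyticAt ℂ s x₀ := ((hg.clog hg_slit).div_const).cexp
  have hs_sq : ∀ z, g z ≠ 0 → s z ^ 2 = g z := by
    intro z hz
    rw [hs, ← exp_nat_mul, Nat.cast_ofNat, mul_div_cancel₀ _ two_ne_zero, exp_log hz]
  have hs_real : ∀ z, 0 < (g z).re → (g z).im = 0 → s z = Real.exp (Real.log ‖g z‖ / 2) := by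
    intro z hre him
    have harg : (g z).arg = 0 := arg_eq_zero_iff.2 ⟨hre.le, him⟩
    have hlog : log (g z) = Real.log ‖g z‖ := by simp [log, harg]
    simp [hs, hlog]
  set h : ℂ → ℂ := fun z => (z - x₀) * s z with hh
  have hh_an : AnalyticAt ℂ h x₀ := (analyticAt_id.sub analyticAt_const).mul hs_an
  set c : ℝ := Real.exp (Real.log ‖g x₀‖ / 2) with hc
  have hc_pos : 0 < c := Real.exp_pos _
  have hd : HasDerivAt h c x₀ := by
    have := ((hasDerivAt_id (x₀ : ℂ)).sub_const (x₀ : ℂ)).mul hs_an.differentiableAt.hasDerivAt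
    refine this.congr_deriv ?_
    simp [hs_real x₀ hg_re hg_im, hc]
  have hh0 : h x₀ = 0 := by simp [hh]
  have hd_ne : deriv h x₀ ≠ 0 := by
    rw [hd.deriv]
    exact_mod_cast hc_pos.ne'
  have hgpos : ∀ᶠ z in 𝓝 (x₀ : ℂ), 0 < (g z).re :=
    (continuous_re.continuousAt.comp hg.continuousAt).eventually (lt_mem_nhds hg_re)
  have hh_real : ∀ᶠ t : ℝ in 𝓝 x₀, (h t).im = 0 := by
    filter_upwards [hreal, (continuous_ofReal.tendsto x₀).eventually hgpos] with t ht hgt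
    rcases eq_or_ne t x₀ with rfl | hne
    · simp [hh0]
    · have him : (g t).im = 0 := by
        have e : f t = (((t - x₀) ^ 2 : ℝ) : ℂ) * g t := by
          rw [hfac]
          push_cast
          rfl
        rw [e, im_ofReal_mul] at ht
        exact (mul_eq_zero.1 ht).resolve_left (pow_ne_zero 2 (sub_ne_zero.2 hne))
      simp only [hh, hs_real t hgt him]
      rw [← ofReal_sub, ← ofReal_mul, ofReal_im]
  set r := hh_an.hasStrictDerivAt.localInverse _ _ _ hd_ne
  have hr_an : AnalyticAt ℂ r 0 := by
    simpa only [hh0] using hh_an.analyticAt_localInverse hd_ne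
  have hr_left : ∀ᶠ z in 𝓝 (x₀ : ℂ), r (h z) = z :=
    HasStrictFDerivAt.eventually_left_inverse _
  have hr_right : ∀ᶠ w in 𝓝 (0 : ℂ), h (r w) = w := by
    have : ∀ᶠ w in 𝓝 (h x₀), h (r w) = w := HasStrictFDerivAt.eventually_right_inverse _
    rwa [hh0] at this
  have hr0 : r 0 = x₀ := by
    have := hr_left.self_of_nhds
    rwa [hh0] at this
  refine ⟨r, hr_an, hr0, ?_, ?_, c⁻¹, inv_pos.2 hc_pos, ?_⟩
  · have hgr : ∀ᶠ w in 𝓝 (0 : ℂ), 0 < (g (r w)).re :=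
      hr_an.continuousAt.eventually (p := fun z => 0 < (g z).re) (by rwa [hr0])
    filter_upwards [hr_right, hgr] with w hw hgw
    have hne : g (r w) ≠ 0 := fun e => by simp [e] at hgw
    rw [hfac, ← hs_sq _ hne, ← mul_pow]
    exact congrArg (· ^ 2) hw
  · refine eventually_im_eq_zero_of_leftInverse hh_an (by simpa using hh0) ?_ hh_real hr_left
    rw [hd.deriv, ofReal_re]
    exact hc_pos.ne'
  · have hd' : HasDerivAt h c (r 0) := by rwa [hr0]
    have hcomp := hd'.comp 0 hr_an.differentiableAt.hasDerivAt
    have hone : HasDerivAt (h ∘ r) 1 0 := (hasDerivAt_id (0 : ℂ)).congr_of_eventuallyEq hr_right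
    have e := hcomp.unique hone
    rw [ofReal_inv]
    exact eq_inv_of_mul_eq_one_right e

/-- The continuous square root `-√τ` for `τ ≥ 0`, `i√(-τ)` for `τ ≤ 0`. -/
noncomputable def leftUpperSqrt (τ : ℝ) : ℂ := -(√τ : ℝ) + (√(-τ) : ℝ) * I

theorem leftUpperSqrt_of_nonneg {τ : ℝ} (hτ : 0 ≤ τ) : leftUpperSqrt τ = ((-√τ : ℝ) : ℂ) := by
  simp [leftUpperSqrt, Real.sqrt_eq_zero_of_nonpos (neg_nonpos.2 hτ)]

theorem leftUpperSqrt_of_nonpos {τ : ℝ} (hτ : τ ≤ 0) : leftUpperSqrt τ = (√(-τ) : ℝ) * I := by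
  simp [leftUpperSqrt, Real.sqrt_eq_zero_of_nonpos hτ]

theorem leftUpperSqrt_zero : leftUpperSqrt 0 = 0 := by
  simp [leftUpperSqrt]

theorem leftUpperSqrt_sq (τ : ℝ) : leftUpperSqrt τ ^ 2 = τ := by
  rcases le_total 0 τ with h | h
  · rw [leftUpperSqrt_of_nonneg h, ← ofReal_pow, neg_sq, Real.sq_sqrt h]
  · rw [leftUpperSqrt_of_nonpos h, mul_pow, I_sq, ← ofReal_pow, Real.sq_sqrt (neg_nonneg.2 h)]
    simp

theorem continuous_leftUpperSqrt : Continuous leftUpperSqrt := by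
  unfold leftUpperSqrt
  fun_prop

theorem analyticAt_leftUpperSqrt {τ : ℝ} (hτ : τ ≠ 0) : AnalyticAt ℝ leftUpperSqrt τ := by
  have hsqrt : ∀ {t : ℝ}, t ≠ 0 → AnalyticAt ℝ (fun x => √x) t := fun ht =>
    (Real.contDiffAt_sqrt ht).analyticAt
  have hneg : AnalyticAt ℝ (fun x : ℝ => √(-x)) τ :=
    AnalyticAt.fun_comp (hsqrt (neg_ne_zero.2 hτ)) analyticAt_id.neg
  have hof : ∀ x : ℝ, AnalyticAt ℝ (fun t : ℝ => (t : ℂ)) x := fun x => ofRealCLM.analyticAt x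
  exact (AnalyticAt.fun_comp (hof _) (hsqrt hτ)).neg.add
    ((AnalyticAt.fun_comp (hof _) hneg).mul analyticAt_const)

/-- If `Q` is holomorphic near `z₀ ∈ ℝ`, real-valued on the reals,
`Q(z₀) = 0`, `Q′(z₀) = 0` and `Q″(z₀) > 0`, then there is a continuous path `α` of
solutions of `Q(α(τ)) = τ` through `z₀`, real-analytic off `τ = 0`, which lies on the
real line with `Q′(α(τ)) < 0` for `τ > 0`, lies in the open upper half-plane for
`τ < 0`, and approaches `z₀` vertically (`arg(α(τ) − z₀) → π/2`) as `τ ↑ 0`. -/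
theorem statement8 (Q : ℂ → ℂ) (U : Set ℂ) (hU : IsOpen U) (z₀ : ℝ)
    (hz₀ : (z₀ : ℂ) ∈ U) (hQ : DifferentiableOn ℂ Q U)
    (hreal : ∀ x : ℝ, (x : ℂ) ∈ U → (Q x).im = 0)
    (h0 : Q z₀ = 0) (h1 : deriv Q z₀ = 0)
    (h2_im : (iteratedDeriv 2 Q z₀).im = 0) (h2_pos : 0 < (iteratedDeriv 2 Q z₀).re) :
    ∃ ε₁ > 0, ∃ ε₂ > 0, ∃ α : ℝ → ℂ, α 0 = z₀ ∧
      ContinuousOn α (Set.Ioo (-ε₁) ε₂) ∧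
      AnalyticOnNhd ℝ α (Set.Ioo (-ε₁) 0) ∧ AnalyticOnNhd ℝ α (Set.Ioo 0 ε₂) ∧
      (∀ τ ∈ Set.Ioo (-ε₁) ε₂, Q (α τ) = (τ : ℂ)) ∧
      (∀ τ ∈ Set.Ioo 0 ε₂, (α τ).im = 0 ∧ (deriv Q (α τ)).im = 0 ∧ (deriv Q (α τ)).re < 0) ∧
      (∀ τ ∈ Set.Ioo (-ε₁) 0, 0 < (α τ).im) ∧
      Tendsto (fun τ : ℝ => Complex.arg (α τ - (z₀ : ℂ)))
        (nhdsWithin 0 (Set.Iio 0)) (nhds (Real.pi / 2)) := by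
  have hUan : ∀ z ∈ U, AnalyticAt ℂ Q z := fun z hz => hQ.analyticAt (hU.mem_nhds hz)
  have hUreal : ∀ x : ℝ, (x : ℂ) ∈ U → ∀ᶠ t : ℝ in 𝓝 x, (Q t).im = 0 := fun x hx => by
    filter_upwards [(continuous_ofReal.tendsto x).eventually (hU.mem_nhds hx)] with t ht
    exact hreal t ht
  obtain ⟨r, hr, hr0, hsq, hr_real, a, ha, hra⟩ :=
    exists_inverse_sq_coordinate (hUan _ hz₀) (hUreal _ hz₀) h0 h1 h2_im h2_pos
  have hv : ContinuousAt (dslope r 0) 0 := continuousAt_dslope_same.2 hr.differentiableAt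
  have hv0 : dslope r 0 0 = a := by rw [dslope_same, hra]
  have hr_sub : ∀ w, r w - z₀ = w * dslope r 0 w := fun w => by
    simpa [hr0] using (sub_smul_dslope r 0 w).symm
  have ev_U : ∀ᶠ w in 𝓝 (0 : ℂ), r w ∈ U := hr.continuousAt.eventually (by rw [hr0]; exact hU.mem_nhds hz₀)
  have ev_v : ∀ᶠ w in 𝓝 (0 : ℂ), 0 < (dslope r 0 w).re :=
    (continuous_re.continuousAt.comp hv).eventually (lt_mem_nhds (by simpa [hra] using ha))
  have ev_d : ∀ᶠ w in 𝓝 (0 : ℂ), 0 < (deriv r w).re :=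
    (continuous_re.continuousAt.comp hr.deriv.continuousAt).eventually
      (lt_mem_nhds (by simpa [hra] using ha))
  have ev_real : ∀ᶠ w in 𝓝 (0 : ℂ), w.im = 0 → (r w).im = 0 := by
    filter_upwards [(continuous_re.tendsto 0).eventually hr_real] with w hw him
    rwa [show ((w.re : ℝ) : ℂ) = w from Complex.ext (by simp) (by simp [him])] at hw
  have ev_all := (continuous_leftUpperSqrt.tendsto' 0 0 leftUpperSqrt_zero).eventually
    (hr.eventually_analyticAt.and <| hsq.eventually_nhds.and <| ev_U.and <| ev_v.and <|
      ev_d.and ev_real)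
  obtain ⟨ε, hε, hball⟩ := Metric.eventually_nhds_iff_ball.1 ev_all
  rw [Real.ball_eq_Ioo, zero_sub, zero_add] at hball
  have hα_an : ∀ τ ∈ Ioo (-ε) ε, τ ≠ 0 → AnalyticAt ℝ (fun τ => r (leftUpperSqrt τ)) τ :=
    fun τ hτ hne => AnalyticAt.fun_comp (hball τ hτ).1.restrictScalars (analyticAt_leftUpperSqrt hne)
  refine ⟨ε, hε, ε, hε, fun τ => r (leftUpperSqrt τ), ?_, ?_, ?_, ?_, ?_, ?_, ?_, ?_⟩
  · simp only [leftUpperSqrt_zero, hr0]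
  · intro τ hτ
    exact (ContinuousAt.comp' (hball τ hτ).1.continuousAt
      continuous_leftUpperSqrt.continuousAt).continuousWithinAt
  · exact fun τ hτ => hα_an τ ⟨hτ.1, hτ.2.trans hε⟩ hτ.2.ne
  · exact fun τ hτ => hα_an τ ⟨(neg_lt_zero.2 hε).trans hτ.1, hτ.2⟩ hτ.1.ne'
  · intro τ hτ
    rw [(hball τ hτ).2.1.self_of_nhds, leftUpperSqrt_sq]
  · intro τ hτ
    obtain ⟨han, hsq', hmem, -, hd, hre⟩ := hball τ ⟨(neg_lt_zero.2 hε).trans hτ.1, hτ.2⟩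
    beta_reduce
    rw [leftUpperSqrt_of_nonneg hτ.1.le] at han hsq' hmem hd hre ⊢
    have him := hre (ofReal_im _)
    set w : ℝ := -√τ
    have hw_neg : w < 0 := neg_lt_zero.2 (Real.sqrt_pos.2 hτ.1)
    have hrw : (((r w).re : ℝ) : ℂ) = r w := Complex.ext (by simp) (by simp [him])
    have hQ_im : (deriv Q (r w)).im = 0 := by
      have hmem' := hmem
      rw [← hrw] at hmem' ⊢
      exact im_deriv_eq_zero_of_eventually_real (hUan _ hmem').differentiableAt (hUreal _ hmem')
    refine ⟨him, hQ_im, ?_⟩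
    have hcomp := (hUan _ hmem).differentiableAt.hasDerivAt.comp (w : ℂ)
      han.differentiableAt.hasDerivAt
    have hpow : HasDerivAt (Q ∘ r) (2 * w) (w : ℂ) :=
      ((hasDerivAt_pow 2 (w : ℂ)).congr_of_eventuallyEq hsq').congr_deriv (by simp)
    have e := congrArg re (hcomp.unique hpow)
    simp only [mul_re, hQ_im, zero_mul, sub_zero, re_ofNat, im_ofNat, ofReal_re] at e
    have hlt : (deriv Q (r w)).re * (deriv r w).re < 0 := by linarith
    exact neg_of_mul_neg_left hlt hd.le
  · intro τ hτ
    obtain ⟨-, -, -, hpos, -, -⟩ := hball τ ⟨hτ.1, hτ.2.trans hε⟩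
    have e := congrArg im (hr_sub (leftUpperSqrt τ))
    beta_reduce
    rw [leftUpperSqrt_of_nonpos hτ.2.le] at e hpos ⊢
    have hs : 0 < √(-τ) := Real.sqrt_pos.2 (neg_pos.2 hτ.2)
    simp only [sub_im, ofReal_im, sub_zero, mul_assoc, im_ofReal_mul, I_mul_im] at e
    rw [e]
    exact mul_pos hs hpos
  · have hslit : I * dslope r 0 0 ∈ slitPlane := by
      rw [hv0]
      exact Or.inr (by simpa using ha.ne')
    have harg : arg (I * dslope r 0 0) = Real.pi / 2 := by
      rw [hv0, mul_comm, arg_real_mul _ ha, arg_I]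
    have hw : Tendsto leftUpperSqrt (𝓝[<] 0) (𝓝 0) :=
      (continuous_leftUpperSqrt.tendsto' 0 0 leftUpperSqrt_zero).mono_left nhdsWithin_le_nhds
    have hlim := (continuousAt_arg hslit).tendsto.comp ((hv.tendsto.comp hw).const_mul I)
    rw [harg] at hlim
    refine hlim.congr' ?_
    filter_upwards [self_mem_nhdsWithin] with τ hτ
    have hs : 0 < √(-τ) := Real.sqrt_pos.2 (neg_pos.2 hτ)
    rw [hr_sub]
    simp only [Function.comp_apply, leftUpperSqrt_of_nonpos (le_of_lt hτ)]
    rw [mul_assoc, arg_real_mul _ hs]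
end

section
/- Let Q be holomorphic on an open set U ⊆ ℂ containing a point z₀ ∈ ℝ, with Q real-valued on U ∩ ℝ. Assume Q(z₀) = 0, Q′(z₀) = 0, Q″(z₀) = 0 and Q‴(z₀) > 0. Then there exist ε₁ > 0, ε₂ > 0 and a continuous function α : (−ε₁, ε₂) → ℂ with α(0) = z₀ such that: (a) Q(α(τ)) = τ for all τ ∈ (−ε₁, ε₂); (b) α is real-analytic on (−ε₁, 0) and on (0, ε₂); (c) α(τ) ∈ ℂ⁺ for all τ ≠ 0; (d) arg(α(τ) − z₀) → π/3 as τ ↑ 0 and arg(α(τ) − z₀) → 2π/3 as τ ↓ 0. -/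
open Complex Filter Set

open scoped Topology

/-- A holomorphic function with Taylor expansion `c z³ + O(z⁴)`, `c > 0`, is the cube of a local
coordinate with positive derivative; `r` is the inverse of that coordinate. -/
theorem exists_analyticAt_comp_eq_pow_three {f : ℂ → ℂ} (hf : AnalyticAt ℂ f 0)
    (h0 : f 0 = 0) (h1 : deriv f 0 = 0) (h2 : iteratedDeriv 2 f 0 = 0)
    {c : ℝ} (hc : 0 < c) (h3 : iteratedDeriv 3 f 0 = c) :
    ∃ r : ℂ → ℂ, ∃ d : ℝ, 0 < d ∧ AnalyticAt ℂ r 0 ∧ r 0 = 0 ∧ HasDerivAt r d 0 ∧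
      ∀ᶠ w in 𝓝 0, f (r w) = w ^ 3 := by
  obtain ⟨F, hF, hfF⟩ := hf.exists_eq_sum_add_pow_mul 4
  have hfg : ∀ z, f z = z ^ 3 * (((c / 6 : ℝ) : ℂ) + z * F z) := by
    intro z
    rw [hfF z]
    simp [Finset.sum_range_succ, h0, h1, h2, h3, Nat.factorial]
    ring
  set g : ℂ → ℂ := fun z => ((c / 6 : ℝ) : ℂ) + z * F z with hg
  have hga : AnalyticAt ℂ g 0 := by fun_prop
  have hg0 : g 0 = ((c / 6 : ℝ) : ℂ) := by simp [hg]
  set b : ℂ → ℂ := fun z => g z ^ (((3 : ℕ) : ℂ)⁻¹) with hb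
  have hba : AnalyticAt ℂ b 0 := by
    refine hga.cpow analyticAt_const ?_
    rw [hg0, ofReal_mem_slitPlane]
    positivity
  have hb0 : b 0 = (((c / 6) ^ ((3 : ℝ)⁻¹) : ℝ) : ℂ) := by
    rw [hb]
    simp only [hg0]
    rw [ofReal_cpow (by positivity)]
    norm_num
  set d : ℝ := (c / 6) ^ ((3 : ℝ)⁻¹) with hd
  have hdpos : 0 < d := by positivity
  set h : ℂ → ℂ := fun z => z * b z with hh
  have hha : AnalyticAt ℂ h 0 := by fun_prop
  have hhz : h 0 = 0 := by simp [hh]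
  have hhd : deriv h 0 = d := by
    have := (hasDerivAt_id (0 : ℂ)).fun_mul hba.differentiableAt.hasDerivAt
    simpa [hh, hb0] using this.deriv
  have hne : deriv h 0 ≠ 0 := by
    rw [hhd]; exact_mod_cast hdpos.ne'
  have hcube : ∀ z, f z = h z ^ 3 := by
    intro z
    rw [hfg, hh, mul_pow, hb, cpow_nat_inv_pow _ three_ne_zero]
  set r := hha.hasStrictDerivAt.localInverse _ _ _ hne with hr
  have hra : AnalyticAt ℂ r (h 0) := hha.analyticAt_localInverse hne
  have hr0 : r (h 0) = 0 := HasStrictFDerivAt.localInverse_apply_image ..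
  have hrd : HasDerivAt r (deriv h 0)⁻¹ (h 0) :=
    (hha.hasStrictDerivAt.to_localInverse hne).hasDerivAt
  have hri : ∀ᶠ w in 𝓝 (h 0), h (r w) = w := HasStrictDerivAt.eventually_right_inverse ..
  rw [hhz] at hra hr0 hrd hri
  refine ⟨r, d⁻¹, by positivity, hra, hr0, by simpa [hhd] using hrd, ?_⟩
  filter_upwards [hri] with w hw
  rw [hcube, hw]

theorem tendsto_arg_comp_mul_nhdsGT {r : ℂ → ℂ} {d : ℝ} (hd : 0 < d) (hr0 : r 0 = 0)
    (hr : HasDerivAt r d 0) {e : ℂ} (he : 0 < e.im) :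
    Tendsto (fun t : ℝ => arg (r (t * e))) (𝓝[>] 0) (𝓝 (arg e)) ∧
      ∀ᶠ t : ℝ in 𝓝[>] 0, 0 < (r (t * e)).im := by
  have hder : HasDerivAt (fun t : ℝ => r (t * e)) (d * e) 0 := by
    have hline : HasDerivAt (fun t : ℝ => (t : ℂ) * e) e 0 := by
      simpa using (ofRealCLM.hasDerivAt (x := (0 : ℝ))).mul_const e
    exact HasDerivAt.comp (0 : ℝ) (h₂ := r) (by simpa using hr) hline
  have hslope : Tendsto (fun t : ℝ => ((t⁻¹ : ℝ) : ℂ) * r (t * e)) (𝓝[>] 0) (𝓝 (d * e)) := by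
    have := hder.tendsto_slope_zero.mono_left
      (nhdsWithin_mono (0 : ℝ) (s := Ioi 0) (fun t ht => ne_of_gt ht))
    simpa [hr0] using this
  have him : 0 < ((d : ℂ) * e).im := by
    rw [im_ofReal_mul]; positivity
  constructor
  · have harg := (continuousAt_arg (Or.inr him.ne')).tendsto.comp hslope
    rw [arg_real_mul _ hd] at harg
    refine harg.congr' ?_
    filter_upwards [self_mem_nhdsWithin] with t ht
    exact arg_real_mul _ (inv_pos.2 ht)
  · have hev := ((continuous_im.tendsto _).comp hslope).eventually (lt_mem_nhds him)
    filter_upwards [hev, self_mem_nhdsWithin] with t ht ht0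
    simp only [Function.comp_apply, im_ofReal_mul] at ht
    exact (pos_iff_pos_of_mul_pos ht).1 (inv_pos.2 ht0)

/-- The continuous cube root of `τ ∈ ℝ` with argument `π / 3` for `τ < 0` and `2 * π / 3` for
`τ > 0`. -/
noncomputable def upperCubeRoot (τ : ℝ) : ℂ :=
  ((max τ 0 ^ (3⁻¹ : ℝ) : ℝ) : ℂ) * exp ((2 * Real.pi / 3 : ℝ) * I) +
    ((max (-τ) 0 ^ (3⁻¹ : ℝ) : ℝ) : ℂ) * exp ((Real.pi / 3 : ℝ) * I)

theorem upperCubeRoot_zero : upperCubeRoot 0 = 0 := by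
  simp [upperCubeRoot]

theorem upperCubeRoot_of_pos {τ : ℝ} (hτ : 0 < τ) :
    upperCubeRoot τ = ((τ ^ (3⁻¹ : ℝ) : ℝ) : ℂ) * exp ((2 * Real.pi / 3 : ℝ) * I) := by
  simp [upperCubeRoot, max_eq_left hτ.le, max_eq_right (neg_nonpos.2 hτ.le)]

theorem upperCubeRoot_of_neg {τ : ℝ} (hτ : τ < 0) :
    upperCubeRoot τ = (((-τ) ^ (3⁻¹ : ℝ) : ℝ) : ℂ) * exp ((Real.pi / 3 : ℝ) * I) := by
  simp [upperCubeRoot, max_eq_right hτ.le, max_eq_left (neg_nonneg.2 hτ.le)]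

theorem continuous_upperCubeRoot : Continuous upperCubeRoot := by
  have hroot : Continuous fun x : ℝ => x ^ (3⁻¹ : ℝ) := Real.continuous_rpow_const (by norm_num)
  have hpos : Continuous fun τ : ℝ => max τ 0 ^ (3⁻¹ : ℝ) := hroot.comp (by fun_prop)
  have hneg : Continuous fun τ : ℝ => max (-τ) 0 ^ (3⁻¹ : ℝ) := hroot.comp (by fun_prop)
  unfold upperCubeRoot
  fun_prop

theorem ofReal_rpow_inv_three_pow {x : ℝ} (hx : 0 ≤ x) :
    ((x ^ (3⁻¹ : ℝ) : ℝ) : ℂ) ^ 3 = x := by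
  have := Real.rpow_inv_natCast_pow hx three_ne_zero
  exact_mod_cast this

theorem upperCubeRoot_pow_three (τ : ℝ) : upperCubeRoot τ ^ 3 = τ := by
  rcases lt_trichotomy τ 0 with hτ | rfl | hτ
  · rw [upperCubeRoot_of_neg hτ, mul_pow, ofReal_rpow_inv_three_pow (neg_nonneg.2 hτ.le),
      ← exp_nat_mul]
    have : ((3 : ℕ) : ℂ) * ((Real.pi / 3 : ℝ) * I) = Real.pi * I := by
      push_cast; ring
    rw [this, exp_pi_mul_I]
    simp
  · simp [upperCubeRoot_zero]
  · rw [upperCubeRoot_of_pos hτ, mul_pow, ofReal_rpow_inv_three_pow hτ.le, ← exp_nat_mul]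
    have : ((3 : ℕ) : ℂ) * ((2 * Real.pi / 3 : ℝ) * I) = 2 * Real.pi * I := by
      push_cast; ring
    rw [this, exp_two_pi_mul_I, mul_one]

theorem analyticAt_upperCubeRoot {τ : ℝ} (hτ : τ ≠ 0) : AnalyticAt ℝ upperCubeRoot τ := by
  have hroot : ∀ x : ℝ, x ≠ 0 → AnalyticAt ℝ (fun x : ℝ => x ^ (3⁻¹ : ℝ)) x := fun x hx =>
    (Real.contDiffAt_rpow_const_of_ne hx).analyticAt
  have hcoe : ∀ x : ℝ, AnalyticAt ℝ (fun x : ℝ => (x : ℂ)) x := fun x => ofRealCLM.analyticAt x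
  rcases hτ.lt_or_gt with hτ | hτ
  · have h : AnalyticAt ℝ (fun x : ℝ => (((-x) ^ (3⁻¹ : ℝ) : ℝ) : ℂ)) τ :=
      (hcoe _).fun_comp ((hroot (-τ) (by linarith)).fun_comp (f := fun x : ℝ => -x) (by fun_prop))
    refine (h.mul (analyticAt_const (v := exp ((Real.pi / 3 : ℝ) * I)))).congr ?_
    filter_upwards [gt_mem_nhds hτ] with x hx
    exact (upperCubeRoot_of_neg hx).symm
  · refine (((hcoe _).fun_comp (hroot τ hτ.ne')).mul
      (analyticAt_const (v := exp ((2 * Real.pi / 3 : ℝ) * I)))).congr ?_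
    filter_upwards [lt_mem_nhds hτ] with x hx
    exact (upperCubeRoot_of_pos hx).symm

theorem tendsto_rpow_inv_three_nhdsGT :
    Tendsto (fun x : ℝ => x ^ (3⁻¹ : ℝ)) (𝓝[>] 0) (𝓝[>] 0) := by
  refine tendsto_nhdsWithin_iff.2 ⟨?_, ?_⟩
  · have : Continuous fun x : ℝ => x ^ (3⁻¹ : ℝ) := Real.continuous_rpow_const (by norm_num)
    simpa using (this.tendsto 0).mono_left nhdsWithin_le_nhds
  · filter_upwards [self_mem_nhdsWithin] with x hx
    exact Real.rpow_pos_of_pos hx _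

theorem tendsto_neg_rpow_inv_three_nhdsLT :
    Tendsto (fun x : ℝ => (-x) ^ (3⁻¹ : ℝ)) (𝓝[<] 0) (𝓝[>] 0) := by
  refine tendsto_rpow_inv_three_nhdsGT.comp ?_
  simpa using tendsto_neg_nhdsLT (a := (0 : ℝ))

theorem arg_exp_ofReal_mul_I_of_mem_Ioo {θ : ℝ} (hθ : θ ∈ Ioo 0 Real.pi) :
    arg (exp (θ * I)) = θ ∧ 0 < (exp (θ * I)).im := by
  constructor
  · rw [exp_mul_I]
    exact arg_cos_add_sin_mul_I ⟨by linarith [hθ.1, Real.pi_pos], hθ.2.le⟩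
  · rw [exp_ofReal_mul_I_im]
    exact Real.sin_pos_of_mem_Ioo hθ

/-- If `Q` is holomorphic near `z₀ ∈ ℝ`, real-valued on the reals,
`Q(z₀) = Q′(z₀) = Q″(z₀) = 0` and `Q‴(z₀) > 0`, then there is a continuous path `α` of
solutions of `Q(α(τ)) = τ` through `z₀`, real-analytic off `τ = 0`, lying in the open
upper half-plane for `τ ≠ 0`, which approaches the real line under angle `π/3` as
`τ ↑ 0` and leaves under angle `2π/3` as `τ ↓ 0`. -/
theorem statement9 (Q : ℂ → ℂ) (U : Set ℂ) (hU : IsOpen U) (z₀ : ℝ)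
    (hz₀ : (z₀ : ℂ) ∈ U) (hQ : DifferentiableOn ℂ Q U)
    (hreal : ∀ x : ℝ, (x : ℂ) ∈ U → (Q x).im = 0)
    (h0 : Q z₀ = 0) (h1 : deriv Q z₀ = 0) (h2 : iteratedDeriv 2 Q z₀ = 0)
    (h3_im : (iteratedDeriv 3 Q z₀).im = 0) (h3_pos : 0 < (iteratedDeriv 3 Q z₀).re) :
    ∃ ε₁ > 0, ∃ ε₂ > 0, ∃ α : ℝ → ℂ, α 0 = z₀ ∧
      ContinuousOn α (Set.Ioo (-ε₁) ε₂) ∧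
      AnalyticOnNhd ℝ α (Set.Ioo (-ε₁) 0) ∧ AnalyticOnNhd ℝ α (Set.Ioo 0 ε₂) ∧
      (∀ τ ∈ Set.Ioo (-ε₁) ε₂, Q (α τ) = (τ : ℂ)) ∧
      (∀ τ ∈ Set.Ioo (-ε₁) ε₂, τ ≠ 0 → 0 < (α τ).im) ∧
      Tendsto (fun τ : ℝ => Complex.arg (α τ - (z₀ : ℂ)))
        (nhdsWithin 0 (Set.Iio 0)) (nhds (Real.pi / 3)) ∧
      Tendsto (fun τ : ℝ => Complex.arg (α τ - (z₀ : ℂ)))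
        (nhdsWithin 0 (Set.Ioi 0)) (nhds (2 * Real.pi / 3)) := by
  have hQa : AnalyticAt ℂ Q z₀ := hQ.analyticAt (hU.mem_nhds hz₀)
  have hfa : AnalyticAt ℂ (fun z => Q (z₀ + z)) 0 := by
    refine AnalyticAt.fun_comp (f := fun z : ℂ => (z₀ : ℂ) + z) ?_ (by fun_prop)
    simpa using hQa
  obtain ⟨r, d, hd, hra, hr0, hrd, hrQ⟩ :=
    exists_analyticAt_comp_eq_pow_three hfa (by simpa using h0)
      (by simpa [deriv_comp_const_add] using h1)
      (by simpa [iteratedDeriv_comp_const_add] using h2) h3_pos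
      (by
        rw [iteratedDeriv_comp_const_add]
        apply Complex.ext <;> simp [h3_im])
  have hs : Tendsto upperCubeRoot (𝓝 0) (𝓝 0) := by
    simpa [upperCubeRoot_zero] using continuous_upperCubeRoot.tendsto 0
  have hpi := Real.pi_pos
  obtain ⟨harg₁, him₁⟩ := arg_exp_ofReal_mul_I_of_mem_Ioo (θ := Real.pi / 3)
    ⟨by linarith, by linarith⟩
  obtain ⟨harg₂, him₂⟩ := arg_exp_ofReal_mul_I_of_mem_Ioo (θ := 2 * Real.pi / 3)
    ⟨by linarith, by linarith⟩
  obtain ⟨htend₁, hpos₁⟩ := tendsto_arg_comp_mul_nhdsGT hd hr0 hrd him₁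
  obtain ⟨htend₂, hpos₂⟩ := tendsto_arg_comp_mul_nhdsGT hd hr0 hrd him₂
  have himL : ∀ᶠ τ in 𝓝[<] 0, 0 < (r (upperCubeRoot τ)).im := by
    filter_upwards [tendsto_neg_rpow_inv_three_nhdsLT.eventually hpos₁, self_mem_nhdsWithin]
      with τ h hτ
    rwa [upperCubeRoot_of_neg hτ]
  have himR : ∀ᶠ τ in 𝓝[>] 0, 0 < (r (upperCubeRoot τ)).im := by
    filter_upwards [tendsto_rpow_inv_three_nhdsGT.eventually hpos₂, self_mem_nhdsWithin]
      with τ h hτ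
    rwa [upperCubeRoot_of_pos hτ]
  have him : ∀ᶠ τ in 𝓝 (0 : ℝ), τ ≠ 0 → 0 < (r (upperCubeRoot τ)).im := by
    have : ∀ᶠ τ in 𝓝[≠] (0 : ℝ), 0 < (r (upperCubeRoot τ)).im := by
      rw [← Iio_union_Ioi, nhdsWithin_union]
      exact eventually_sup.2 ⟨himL, himR⟩
    exact eventually_nhdsWithin_iff.1 this
  obtain ⟨ε, hε, hball⟩ := Metric.eventually_nhds_iff.1
    ((hs.eventually hra.eventually_analyticAt).and ((hs.eventually hrQ).and him))
  have hmem : ∀ τ ∈ Ioo (-ε) ε, AnalyticAt ℂ r (upperCubeRoot τ) ∧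
      Q (z₀ + r (upperCubeRoot τ)) = upperCubeRoot τ ^ 3 ∧
      (τ ≠ 0 → 0 < (r (upperCubeRoot τ)).im) := fun τ hτ =>
    hball (by rw [Real.dist_0_eq_abs]; exact abs_lt.2 hτ)
  have han : ∀ τ ∈ Ioo (-ε) ε, τ ≠ 0 →
      AnalyticAt ℝ (fun τ => (z₀ : ℂ) + r (upperCubeRoot τ)) τ := fun τ hτ hτ0 =>
    analyticAt_const.add ((hmem τ hτ).1.restrictScalars.fun_comp (analyticAt_upperCubeRoot hτ0))
  refine ⟨ε, hε, ε, hε, fun τ => z₀ + r (upperCubeRoot τ), ?_, ?_, ?_, ?_, ?_, ?_, ?_, ?_⟩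
  · simp [upperCubeRoot_zero, hr0]
  · intro τ hτ
    exact (continuousAt_const.add ((hmem τ hτ).1.continuousAt.comp
      continuous_upperCubeRoot.continuousAt)).continuousWithinAt
  · exact fun τ hτ => han τ ⟨hτ.1, hτ.2.trans hε⟩ hτ.2.ne
  · exact fun τ hτ => han τ ⟨by linarith [hτ.1], hτ.2⟩ hτ.1.ne'
  · intro τ hτ
    rw [(hmem τ hτ).2.1, upperCubeRoot_pow_three]
  · intro τ hτ hτ0
    simpa using (hmem τ hτ).2.2 hτ0
  · rw [harg₁] at htend₁
    refine (htend₁.comp tendsto_neg_rpow_inv_three_nhdsLT).congr' ?_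
    filter_upwards [self_mem_nhdsWithin] with τ hτ
    simp only [Function.comp_apply, add_sub_cancel_left, upperCubeRoot_of_neg hτ]
  · rw [harg₂] at htend₂
    refine (htend₂.comp tendsto_rpow_inv_three_nhdsGT).congr' ?_
    filter_upwards [self_mem_nhdsWithin] with τ hτ
    simp only [Function.comp_apply, add_sub_cancel_left, upperCubeRoot_of_pos hτ]
end
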